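/- arXiv:1611.00479 — 2 statements merged into one kernel-verified Lean document; each statement's English description precedes it below -/
import Mathlib

section
/- Let N ≥ 2. The average of the entangling power e_p(U) over U drawn from the Haar probability measure on the unitary group U(N²) (acting on ℂ^N ⊗ ℂ^N) equals (N−1)²/(N²+1). -/
open Matrix MeasureTheory
open scoped Kronecker

noncomputable section

instance {m n R : Type*} [TopologicalSpace R] : MeasurableSpace (Matrix m n R) := borel _
instance {m n R : Type*} [TopologicalSpace R] : BorelSpace (Matrix m n R) := ⟨rfl⟩

/-- Reshuffling: `(U_R)_{(i,j),(α,β)} = U_{(i,α),(j,β)}`. -/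
def reshuffle (N : ℕ) (U : Matrix (Fin N × Fin N) (Fin N × Fin N) ℂ) :
    Matrix (Fin N × Fin N) (Fin N × Fin N) ℂ :=
  Matrix.of fun p q => U (p.1, q.1) (p.2, q.2)

/-- Partial transpose: `(U_Γ)_{(j,α),(i,β)} = U_{(i,α),(j,β)}`. -/
def ptransp (N : ℕ) (U : Matrix (Fin N × Fin N) (Fin N × Fin N) ℂ) :
    Matrix (Fin N × Fin N) (Fin N × Fin N) ℂ :=
  Matrix.of fun p q => U (q.1, p.2) (p.1, q.2)

/-- The swap gate `S(x ⊗ y) = y ⊗ x`. -/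
def swapGate (N : ℕ) : Matrix (Fin N × Fin N) (Fin N × Fin N) ℂ :=
  Matrix.of fun p q => if p.1 = q.2 ∧ p.2 = q.1 then 1 else 0

/-- `ρ_R(U) = U_R U_R† / N²`. -/
def rhoR (N : ℕ) (U : Matrix (Fin N × Fin N) (Fin N × Fin N) ℂ) :
    Matrix (Fin N × Fin N) (Fin N × Fin N) ℂ :=
  ((N : ℂ) ^ 2)⁻¹ • (reshuffle N U * (reshuffle N U)ᴴ)

/-- `ρ_T(U) = S U_Γ U_Γ† S / N²`. -/
def rhoT (N : ℕ) (U : Matrix (Fin N × Fin N) (Fin N × Fin N) ℂ) :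
    Matrix (Fin N × Fin N) (Fin N × Fin N) ℂ :=
  ((N : ℂ) ^ 2)⁻¹ • (swapGate N * (ptransp N U * (ptransp N U)ᴴ) * swapGate N)

/-- Purity `X(U) = tr(ρ_R(U)²)` (a real number). -/
def Xpur (N : ℕ) (U : Matrix (Fin N × Fin N) (Fin N × Fin N) ℂ) : ℝ :=
  ((rhoR N U * rhoR N U).trace).re

/-- Purity `Y(U) = tr(ρ_T(U)²)` (a real number). -/
def Ypur (N : ℕ) (U : Matrix (Fin N × Fin N) (Fin N × Fin N) ℂ) : ℝ :=
  ((rhoT N U * rhoT N U).trace).re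

/-- Entangling power `e_p(U)`. -/
def ep (N : ℕ) (U : Matrix (Fin N × Fin N) (Fin N × Fin N) ℂ) : ℝ :=
  ((N : ℝ) ^ 2 / ((N : ℝ) + 1) ^ 2) *
    ((1 - Xpur N U) + (1 - Ypur N U) - ((N : ℝ) ^ 2 - 1) / (N : ℝ) ^ 2)

/-- Gate typicality `g_t(U)`. -/
def gateTyp (N : ℕ) (U : Matrix (Fin N × Fin N) (Fin N × Fin N) ℂ) : ℝ :=
  ((N : ℝ) ^ 2 / ((N : ℝ) ^ 2 - 1)) *
    (Ypur N U - Xpur N U + ((N : ℝ) ^ 2 - 1) / (N : ℝ) ^ 2)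

/-- Mean entangling power over the Haar measure, `ē_p = (N-1)²/(N²+1)`. -/
def epBar (N : ℕ) : ℝ := ((N : ℝ) - 1) ^ 2 / ((N : ℝ) ^ 2 + 1)

/-- `iterGate U W k = U · W_{k-1} · U ⋯ W_0 · U`, i.e. `U^(k+1)` with `k` interlacing
local gates `W_0, …, W_{k-1}`. -/
def iterGate {D : Type*} [Fintype D] [DecidableEq D] (U : Matrix D D ℂ)
    (W : ℕ → Matrix D D ℂ) : ℕ → Matrix D D ℂ
  | 0 => U
  | k + 1 => U * W k * iterGate U W k

section UnitaryMoments

open ComplexConjugate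

variable {D : Type*} [Fintype D] [DecidableEq D]

/-- The diagonal unitary with entry `I` at `x` and `1` elsewhere. -/
def phaseUnitary (x : D) : Matrix.unitaryGroup D ℂ :=
  ⟨Matrix.diagonal fun z => if z = x then Complex.I else 1, by
    rw [Matrix.mem_unitaryGroup_iff, Matrix.star_eq_conjTranspose, Matrix.diagonal_conjTranspose,
      Matrix.diagonal_mul_diagonal, ← Matrix.diagonal_one]
    congr 1
    funext z
    by_cases h : z = x <;> simp [h]⟩

lemma phaseUnitary_row_sum (x a : D) (f : D → ℂ) :
    ∑ z, (phaseUnitary x : Matrix D D ℂ) a z * f z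
      = (if a = x then Complex.I else 1) * f a := by
  simp [phaseUnitary, Matrix.diagonal_apply]

lemma phaseUnitary_row_sum_conj (x a : D) (f : D → ℂ) :
    ∑ z, conj ((phaseUnitary x : Matrix D D ℂ) a z) * f z
      = conj (if a = x then Complex.I else 1) * f a := by
  simp [phaseUnitary, Matrix.diagonal_apply, apply_ite conj]

/-- A unitary whose row at `a` is `r` at `a`, `s` at `b` and zero elsewhere. -/
lemma exists_unitary_row {a b : D} (hab : a ≠ b) (r s : ℝ) (h : r ^ 2 + s ^ 2 = 1) :
    ∃ V : Matrix.unitaryGroup D ℂ, ∀ z,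
      (V : Matrix D D ℂ) a z = ((if z = a then r else if z = b then s else 0 : ℝ) : ℂ) := by
  have hc : (r : ℂ) * r + s * s = 1 := by
    rw [← sq, ← sq]; exact_mod_cast h
  let M : Matrix D D ℂ := Matrix.of fun x z =>
    if x = a then (if z = a then (r : ℂ) else if z = b then (s : ℂ) else 0)
    else if x = b then (if z = a then (s : ℂ) else if z = b then -(r : ℂ) else 0)
    else if x = z then 1 else 0
  refine ⟨⟨M, ?_⟩, fun z => ?_⟩
  · rw [Matrix.mem_unitaryGroup_iff, Matrix.star_eq_conjTranspose]
    have key (α β : ℂ) (g : D → ℂ) :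
        ∑ z, (if z = a then α else if z = b then β else 0) * g z = α * g a + β * g b := by
      rw [Fintype.sum_eq_add a b hab]
      · simp [hab.symm]
      · rintro z ⟨h1, h2⟩; simp [h1, h2]
    ext x y
    rw [Matrix.mul_apply, Matrix.one_apply]
    simp only [Matrix.conjTranspose_apply]
    by_cases hxa : x = a
    · subst hxa
      simp only [M, Matrix.of_apply, if_true]
      rw [key]
      by_cases hy : y = x
      · subst hy; simp [hab.symm, hc]
      · by_cases hy' : y = b
        · subst hy'; simp [hab, hab.symm]; ring
        · simp [hy, hy', Ne.symm hy]
    · by_cases hxb : x = b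
      · subst hxb
        simp only [M, Matrix.of_apply, if_true, hxa, if_false]
        rw [key]
        by_cases hy : y = a
        · subst hy; simp [hab.symm]; ring
        · by_cases hy' : y = x
          · subst hy'; simp [hab.symm]; linear_combination hc
          · simp [hy, hy', Ne.symm hy']
      · simp only [M, Matrix.of_apply, hxa, hxb, if_false, ite_mul, one_mul, zero_mul,
          Finset.sum_ite_eq, Finset.mem_univ, if_true]
        by_cases hy : y = a
        · subst hy; simp [hxa]
        · by_cases hy' : y = b
          · subst hy'; simp [hxb, hy]
          · simp [hy, hy', apply_ite, eq_comm]
  · simp only [M, Matrix.of_apply, if_true]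
    split_ifs <;> simp

/-- A four-index tensor invariant under `V ⊗ V ⊗ conj V ⊗ conj V` and symmetric in each pair of indices
is a multiple of the projection onto the symmetric subspace. -/
lemma symm_invariant_tensor_eq (W : D → D → D → D → ℂ)
    (hinv : ∀ (V : Matrix.unitaryGroup D ℂ) a b c d, W a b c d =
      ∑ a', (V : Matrix D D ℂ) a a' * ∑ b', (V : Matrix D D ℂ) b b' *
        ∑ c', conj ((V : Matrix D D ℂ) c c') * ∑ d', conj ((V : Matrix D D ℂ) d d') *
          W a' b' c' d')
    (h12 : ∀ a b c d, W a b c d = W b a c d) (h34 : ∀ a b c d, W a b c d = W a b d c)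
    (o a b c d : D) :
    W a b c d = W o o o o / 2 *
      ((if a = c ∧ b = d then 1 else 0) + (if a = d ∧ b = c then 1 else 0)) := by
  have hzero {a b c d : D} (h1 : ¬ (a = c ∧ b = d)) (h2 : ¬ (a = d ∧ b = c)) :
      W a b c d = 0 := by
    have hph (x : D) : W a b c d = (if a = x then Complex.I else 1) *
        ((if b = x then Complex.I else 1) * (conj (if c = x then Complex.I else 1) *
          (conj (if d = x then Complex.I else 1) * W a b c d))) := by
      have := hinv (phaseUnitary x) a b c d
      simpa only [phaseUnitary_row_sum, phaseUnitary_row_sum_conj] using this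
    have hI : (1 : ℂ) - Complex.I ≠ 0 := fun h => by simpa using congrArg Complex.re h
    have hcancel (h : W a b c d = Complex.I * W a b c d) : W a b c d = 0 :=
      (mul_eq_zero.1 (by linear_combination h : (1 - Complex.I) * W a b c d = 0)).resolve_left hI
    by_cases hac : a = c
    · subst hac
      have hbd : b ≠ d := fun h => h1 ⟨rfl, h⟩
      apply hcancel
      have := hph b
      by_cases hab : a = b
      · simp only [hab, if_true, hbd.symm, if_false, map_one, Complex.conj_I] at this ⊢
        linear_combination this - Complex.I * W b b b d * Complex.I_mul_I
      · simpa [hab, hbd.symm] using this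
    · by_cases had : a = d
      · subst had
        have hbc : b ≠ c := fun h => h2 ⟨rfl, h⟩
        apply hcancel
        have := hph b
        by_cases hab : a = b
        · simp only [hab, if_true, hbc.symm, if_false, map_one, Complex.conj_I] at this ⊢
          linear_combination this - Complex.I * W b b c b * Complex.I_mul_I
        · simpa [hab, hbc.symm] using this
      · have := hph a
        by_cases hba : b = a
        · simp only [hba, if_true, Ne.symm hac, Ne.symm had, if_false, map_one] at this ⊢
          linear_combination this / 2 + W a a c d / 2 * Complex.I_mul_I
        · apply hcancel
          simpa [hba, Ne.symm hac, Ne.symm had] using this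
  have hrot {a b : D} (hab : a ≠ b) (r s : ℝ) (h : r ^ 2 + s ^ 2 = 1) :
      W a a a a = r ^ 4 * W a a a a + s ^ 4 * W b b b b + 4 * (r ^ 2 * s ^ 2) * W a b a b := by
    obtain ⟨V, hV⟩ := exists_unitary_row hab r s h
    have key (f : D → ℂ) : ∑ z, (V : Matrix D D ℂ) a z * f z = r * f a + s * f b := by
      rw [Fintype.sum_eq_add a b hab]
      · simp [hV, hab.symm]
      · rintro z ⟨h1, h2⟩; simp [hV, h1, h2]
    have key' (f : D → ℂ) : ∑ z, conj ((V : Matrix D D ℂ) a z) * f z = r * f a + s * f b := by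
      rw [← key]
      exact Finset.sum_congr rfl fun z _ => by rw [hV, Complex.conj_ofReal]
    have := hinv V a a a a
    simp only [key, key'] at this
    rw [hzero (a := a) (b := a) (c := a) (d := b) (by tauto) (by tauto),
      hzero (a := a) (b := a) (c := b) (d := a) (by tauto) (by tauto),
      hzero (a := a) (b := a) (c := b) (d := b) (by tauto) (by tauto),
      hzero (a := a) (b := b) (c := a) (d := a) (by tauto) (by tauto),
      hzero (a := a) (b := b) (c := b) (d := b) (by tauto) (by tauto),
      hzero (a := b) (b := a) (c := a) (d := a) (by tauto) (by tauto),
      hzero (a := b) (b := a) (c := b) (d := b) (by tauto) (by tauto),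
      hzero (a := b) (b := b) (c := a) (d := a) (by tauto) (by tauto),
      hzero (a := b) (b := b) (c := a) (d := b) (by tauto) (by tauto),
      hzero (a := b) (b := b) (c := b) (d := a) (by tauto) (by tauto),
      h12 b a a b, h12 b a b a, h34 a b b a] at this
    linear_combination this
  have hdiag (a b : D) : W a a a a = W b b b b := by
    by_cases hab : a = b
    · rw [hab]
    · simpa using hrot hab 0 1 (by norm_num)
  have hoff {a b : D} (hab : a ≠ b) : W a b a b = W a a a a / 2 := by
    have h := hrot hab (3 / 5) (4 / 5) (by norm_num)
    rw [hdiag b a] at h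
    push_cast at h
    linear_combination (-625 / 576 : ℂ) * h
  rw [hdiag o a]
  by_cases h1 : a = c ∧ b = d
  · obtain ⟨rfl, rfl⟩ := h1
    by_cases hab : a = b
    · subst hab; simp; ring
    · rw [hoff hab]; simp [hab]
  · by_cases h2 : a = d ∧ b = c
    · obtain ⟨rfl, rfl⟩ := h2
      have hab : a ≠ b := fun h => h1 ⟨h, h.symm⟩
      rw [h34, hoff hab]; simp [hab]
    · rw [hzero h1 h2]; simp [h1, h2]

/-- The integrand of the second moment of the matrix entries. -/
def momentFun (a b c d e f g h : D) (u : Matrix.unitaryGroup D ℂ) : ℂ :=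
  (u : Matrix D D ℂ) a e * ((u : Matrix D D ℂ) b f *
    (conj ((u : Matrix D D ℂ) c g) * conj ((u : Matrix D D ℂ) d h)))

lemma continuous_momentFun (a b c d e f g h : D) : Continuous (momentFun a b c d e f g h) := by
  have hent (a e : D) : Continuous fun u : Matrix.unitaryGroup D ℂ => (u : Matrix D D ℂ) a e :=
    continuous_subtype_val.matrix_elem a e
  unfold momentFun
  exact (hent a e).mul ((hent b f).mul
    ((Complex.continuous_conj.comp (hent c g)).mul (Complex.continuous_conj.comp (hent d h))))

lemma norm_momentFun_le (a b c d e f g h : D) (u : Matrix.unitaryGroup D ℂ) :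
    ‖momentFun a b c d e f g h u‖ ≤ 1 := by
  have hent (a e : D) : ‖(u : Matrix D D ℂ) a e‖ ≤ 1 := entry_norm_bound_of_unitary u.2 a e
  simp only [momentFun, norm_mul, RCLike.norm_conj]
  have h3 := mul_le_one₀ (hent c g) (norm_nonneg _) (hent d h)
  have h2 := mul_le_one₀ (hent b f) (by positivity) h3
  exact mul_le_one₀ (hent a e) (by positivity) h2

variable (μ : Measure (Matrix.unitaryGroup D ℂ))

lemma integrable_momentFun [IsFiniteMeasure μ] (a b c d e f g h : D) :
    Integrable (momentFun a b c d e f g h) μ :=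
  Integrable.of_bound (continuous_momentFun a b c d e f g h).aestronglyMeasurable 1
    (Filter.Eventually.of_forall (norm_momentFun_le a b c d e f g h))

/-- The second moment of the matrix entries. -/
def moment (a b c d e f g h : D) : ℂ := ∫ u, momentFun a b c d e f g h u ∂μ

lemma momentFun_mul (V u : Matrix.unitaryGroup D ℂ) (a b c d e f g h : D) :
    momentFun a b c d e f g h (V * u) =
      ∑ a', ∑ b', ∑ c', ∑ d', (V : Matrix D D ℂ) a a' * ((V : Matrix D D ℂ) b b' *
        (conj ((V : Matrix D D ℂ) c c') * conj ((V : Matrix D D ℂ) d d'))) *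
          momentFun a' b' c' d' e f g h u := by
  simp only [momentFun, Matrix.UnitaryGroup.mul_val, Matrix.mul_apply, map_sum, map_mul,
    Finset.sum_mul_sum]
  simp only [Finset.mul_sum]
  refine Finset.sum_congr rfl fun a' _ => ?_
  refine Finset.sum_congr rfl fun b' _ => ?_
  refine Finset.sum_congr rfl fun c' _ => ?_
  refine Finset.sum_congr rfl fun d' _ => ?_
  ring

lemma moment_invariant [μ.IsHaarMeasure] [IsFiniteMeasure μ] (V : Matrix.unitaryGroup D ℂ)
    (a b c d e f g h : D) :
    moment μ a b c d e f g h =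
      ∑ a', (V : Matrix D D ℂ) a a' * ∑ b', (V : Matrix D D ℂ) b b' *
        ∑ c', conj ((V : Matrix D D ℂ) c c') * ∑ d', conj ((V : Matrix D D ℂ) d d') *
          moment μ a' b' c' d' e f g h := by
  have hint (k : ℂ) (a' b' c' d' : D) :
      Integrable (fun u => k * momentFun a' b' c' d' e f g h u) μ :=
    (integrable_momentFun μ a' b' c' d' e f g h).const_mul k
  rw [moment, ← integral_mul_left_eq_self _ V]
  simp only [momentFun_mul]
  rw [integral_finsetSum _ fun a' _ => integrable_finsetSum _ fun b' _ =>
    integrable_finsetSum _ fun c' _ => integrable_finsetSum _ fun d' _ => hint _ _ _ _ _]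
  refine Finset.sum_congr rfl fun a' _ => ?_
  rw [integral_finsetSum _ fun b' _ =>
    integrable_finsetSum _ fun c' _ => integrable_finsetSum _ fun d' _ => hint _ _ _ _ _,
    Finset.mul_sum]
  refine Finset.sum_congr rfl fun b' _ => ?_
  rw [integral_finsetSum _ fun c' _ => integrable_finsetSum _ fun d' _ => hint _ _ _ _ _,
    Finset.mul_sum, Finset.mul_sum]
  refine Finset.sum_congr rfl fun c' _ => ?_
  rw [integral_finsetSum _ fun d' _ => hint _ _ _ _ _,
    Finset.mul_sum, Finset.mul_sum, Finset.mul_sum]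
  refine Finset.sum_congr rfl fun d' _ => ?_
  rw [integral_const_mul, moment]
  ring

lemma sum_mul_conj_col (u : Matrix.unitaryGroup D ℂ) (e g : D) :
    ∑ a, (u : Matrix D D ℂ) a e * conj ((u : Matrix D D ℂ) a g) = if e = g then 1 else 0 := by
  have := congrFun (congrFun (Matrix.mem_unitaryGroup_iff'.1 u.2) g) e
  rw [Matrix.star_eq_conjTranspose, Matrix.mul_apply, Matrix.one_apply] at this
  simp only [Matrix.conjTranspose_apply] at this
  simp only [eq_comm (a := e)]
  rw [← this]
  exact Finset.sum_congr rfl fun a _ => mul_comm _ _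

lemma sum_momentFun_parallel (u : Matrix.unitaryGroup D ℂ) (e f g h : D) :
    ∑ a, ∑ b, momentFun a b a b e f g h u = if e = g ∧ f = h then 1 else 0 := by
  trans (∑ a, (u : Matrix D D ℂ) a e * conj ((u : Matrix D D ℂ) a g)) *
      ∑ b, (u : Matrix D D ℂ) b f * conj ((u : Matrix D D ℂ) b h)
  · rw [Finset.sum_mul_sum]
    refine Finset.sum_congr rfl fun a _ => Finset.sum_congr rfl fun b _ => ?_
    rw [momentFun]; ring
  · simp only [sum_mul_conj_col, ite_and]; split_ifs <;> simp

lemma momentFun_swap (a b c d e f g h : D) :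
    momentFun a b c d e f g h = momentFun a b d c e f h g := by
  funext u; simp only [momentFun]; ring

lemma sum_moment_parallel [IsProbabilityMeasure μ] (e f g h : D) :
    ∑ a, ∑ b, moment μ a b a b e f g h = if e = g ∧ f = h then 1 else 0 := by
  have hi := fun a b : D => integrable_momentFun μ a b a b e f g h
  simp only [moment]
  simp_rw [← integral_finsetSum Finset.univ fun b _ => hi _ b]
  rw [← integral_finsetSum _ fun a _ => integrable_finsetSum _ fun b _ => hi a b]
  simp [sum_momentFun_parallel]

lemma sum_moment_crossed [IsProbabilityMeasure μ] (e f g h : D) :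
    ∑ a, ∑ b, moment μ a b b a e f g h = if e = h ∧ f = g then 1 else 0 := by
  rw [← sum_moment_parallel μ]
  simp only [moment, momentFun_swap _ _ _ _ e f g h]

/-- The row-symmetrized second moment of the Haar measure on the unitary group. -/
theorem symm_moment_eq [μ.IsHaarMeasure] [IsProbabilityMeasure μ] [Nonempty D]
    (a b c d e f g h : D) :
    moment μ a b c d e f g h + moment μ a b d c e f g h +
      moment μ b a c d e f g h + moment μ b a d c e f g h =
    2 / ((Fintype.card D : ℂ) * (Fintype.card D + 1)) *
      ((if e = g ∧ f = h then 1 else 0) + (if e = h ∧ f = g then 1 else 0)) *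
      ((if a = c ∧ b = d then 1 else 0) + (if a = d ∧ b = c then 1 else 0)) := by
  let W : D → D → D → D → ℂ := fun a b c d =>
    moment μ a b c d e f g h + moment μ a b d c e f g h +
      moment μ b a c d e f g h + moment μ b a d c e f g h
  obtain ⟨o⟩ := ‹Nonempty D›
  have hinv (V : Matrix.unitaryGroup D ℂ) (a b c d : D) : W a b c d =
      ∑ a', (V : Matrix D D ℂ) a a' * ∑ b', (V : Matrix D D ℂ) b b' *
        ∑ c', conj ((V : Matrix D D ℂ) c c') * ∑ d', conj ((V : Matrix D D ℂ) d d') *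
          W a' b' c' d' := by
    have comm34 (F : D → D → ℂ) (c d : D) :
        ∑ c', conj ((V : Matrix D D ℂ) c c') * ∑ d', conj ((V : Matrix D D ℂ) d d') * F d' c' =
        ∑ d', conj ((V : Matrix D D ℂ) d d') * ∑ c', conj ((V : Matrix D D ℂ) c c') * F d' c' := by
      simp only [Finset.mul_sum]
      rw [Finset.sum_comm]
      exact Finset.sum_congr rfl fun _ _ => Finset.sum_congr rfl fun _ _ => by ring
    have comm12 (F : D → D → ℂ) (a b : D) :
        ∑ a', (V : Matrix D D ℂ) a a' * ∑ b', (V : Matrix D D ℂ) b b' * F b' a' =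
        ∑ b', (V : Matrix D D ℂ) b b' * ∑ a', (V : Matrix D D ℂ) a a' * F b' a' := by
      simp only [Finset.mul_sum]
      rw [Finset.sum_comm]
      exact Finset.sum_congr rfl fun _ _ => Finset.sum_congr rfl fun _ _ => by ring
    simp only [W, mul_add, Finset.sum_add_distrib]
    congr 1
    · congr 1
      · congr 1
        · exact moment_invariant μ V a b c d e f g h
        · rw [moment_invariant μ V a b d c e f g h]
          simp only [comm34 (fun d' c' => moment μ _ _ d' c' e f g h) c d]
      · rw [moment_invariant μ V b a c d e f g h]
        exact (comm12 (fun b' a' => _) a b).symm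
    · rw [moment_invariant μ V b a d c e f g h]
      simp only [comm34 (fun d' c' => moment μ _ _ d' c' e f g h) c d]
      exact (comm12 (fun b' a' => _) a b).symm
  have hW := symm_invariant_tensor_eq W hinv (fun a b c d => by simp only [W]; ring)
    (fun a b c d => by simp only [W]; ring) o
  have hsum : ∑ a, ∑ b, W a b a b =
      2 * ((if e = g ∧ f = h then 1 else 0) + (if e = h ∧ f = g then 1 else 0)) := by
    simp only [W, Finset.sum_add_distrib, sum_moment_parallel, sum_moment_crossed]
    rw [Finset.sum_comm (f := fun a b => moment μ b a a b e f g h),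
      Finset.sum_comm (f := fun a b => moment μ b a b a e f g h),
      sum_moment_parallel, sum_moment_crossed]
    ring
  have hsum' : ∑ a, ∑ b, W a b a b =
      W o o o o / 2 * ((Fintype.card D : ℂ) * (Fintype.card D + 1)) := by
    rw [Finset.sum_congr rfl fun a _ => Finset.sum_congr rfl fun b _ => hW a b a b]
    simp_rw [← Finset.mul_sum]
    congr 1
    have (a b : D) : (if a = b ∧ b = a then (1 : ℂ) else 0) = if a = b then 1 else 0 := by
      simp [eq_comm]
    simp [Finset.sum_add_distrib, this]
    ring
  have hcard : (Fintype.card D : ℂ) ≠ 0 := Nat.cast_ne_zero.2 (Fintype.card_pos_iff.2 ⟨o⟩).ne'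
  have hcard' : (Fintype.card D : ℂ) + 1 ≠ 0 := Nat.cast_add_one_ne_zero _
  change W a b c d = _
  rw [hW]
  congr 1
  rw [hsum] at hsum'
  generalize W o o o o = t at hsum'
  field_simp
  linear_combination -2 * hsum'

end UnitaryMoments

section Purities

open ComplexConjugate

variable {N : ℕ}

lemma trace_mul_conjTranspose_sq {D : Type*} [Fintype D] (A : Matrix D D ℂ) :
    (A * Aᴴ * (A * Aᴴ)).trace =
      ∑ p, ∑ r, ∑ q, ∑ s, A p q * (A r s * (conj (A r q) * conj (A p s))) := by
  simp only [Matrix.trace, Matrix.diag_apply, Matrix.mul_apply, Finset.sum_mul_sum,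
    Matrix.conjTranspose_apply]
  refine Finset.sum_congr rfl fun p _ => Finset.sum_congr rfl fun r _ =>
    Finset.sum_congr rfl fun q _ => Finset.sum_congr rfl fun s _ => ?_
  simp only [starRingEnd_apply]
  ring

lemma swapGate_mul_self : swapGate N * swapGate N = 1 := by
  ext ⟨a, b⟩ ⟨c, d⟩
  simp only [swapGate, Matrix.mul_apply, Matrix.of_apply, Matrix.one_apply, Fintype.sum_prod_type,
    Prod.mk.injEq]
  rw [Finset.sum_eq_single b, Finset.sum_eq_single a]
  · simp [and_comm]
  · intro x _ hx; simp [Ne.symm hx]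
  · simp
  · intro x _ hx; simp [Ne.symm hx]
  · simp

lemma trace_rhoT_sq (U : Matrix (Fin N × Fin N) (Fin N × Fin N) ℂ) :
    (rhoT N U * rhoT N U).trace = ((N : ℂ) ^ 4)⁻¹ *
      (ptransp N U * (ptransp N U)ᴴ * (ptransp N U * (ptransp N U)ᴴ)).trace := by
  set M := ptransp N U * (ptransp N U)ᴴ with hM
  have h : swapGate N * M * swapGate N * (swapGate N * M * swapGate N)
      = swapGate N * (M * M) * swapGate N := by
    calc _ = swapGate N * M * (swapGate N * swapGate N) * M * swapGate N := by noncomm_ring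
      _ = _ := by rw [swapGate_mul_self]; noncomm_ring
  rw [rhoT, ← hM, Matrix.smul_mul, Matrix.mul_smul, smul_smul, h, Matrix.trace_smul,
    Matrix.trace_mul_comm, ← mul_assoc, swapGate_mul_self, one_mul, smul_eq_mul, ← mul_inv]
  ring

lemma trace_rhoR_sq (U : Matrix (Fin N × Fin N) (Fin N × Fin N) ℂ) :
    (rhoR N U * rhoR N U).trace = ((N : ℂ) ^ 4)⁻¹ *
      (reshuffle N U * (reshuffle N U)ᴴ * (reshuffle N U * (reshuffle N U)ᴴ)).trace := by
  rw [rhoR, Matrix.smul_mul, Matrix.mul_smul, smul_smul, Matrix.trace_smul, smul_eq_mul,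
    ← mul_inv]
  ring

lemma trace_rhoR_sq_eq (u : Matrix.unitaryGroup (Fin N × Fin N) ℂ) :
    (rhoR N u * rhoR N u).trace = ((N : ℂ) ^ 4)⁻¹ *
      ∑ t : (Fin N × Fin N) × (Fin N × Fin N) × (Fin N × Fin N) × (Fin N × Fin N),
        momentFun (t.1.1, t.2.2.1.1) (t.2.1.1, t.2.2.2.1) (t.2.1.1, t.2.2.1.1) (t.1.1, t.2.2.2.1)
          (t.1.2, t.2.2.1.2) (t.2.1.2, t.2.2.2.2) (t.2.1.2, t.2.2.1.2) (t.1.2, t.2.2.2.2) u := by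
  rw [trace_rhoR_sq, trace_mul_conjTranspose_sq]
  simp only [Fintype.sum_prod_type (α₁ := Fin N × Fin N)]
  rfl

lemma trace_rhoT_sq_eq (u : Matrix.unitaryGroup (Fin N × Fin N) ℂ) :
    (rhoT N u * rhoT N u).trace = ((N : ℂ) ^ 4)⁻¹ *
      ∑ t : (Fin N × Fin N) × (Fin N × Fin N) × (Fin N × Fin N) × (Fin N × Fin N),
        momentFun (t.1.1, t.2.2.1.1) (t.2.1.1, t.2.2.2.1) (t.1.1, t.2.2.2.1) (t.2.1.1, t.2.2.1.1)
          (t.1.2, t.2.2.1.2) (t.2.1.2, t.2.2.2.2) (t.2.1.2, t.2.2.1.2) (t.1.2, t.2.2.2.2) u := by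
  rw [trace_rhoT_sq, trace_mul_conjTranspose_sq]
  congr 1
  trans ∑ t : (Fin N × Fin N) × (Fin N × Fin N) × (Fin N × Fin N) × (Fin N × Fin N),
    momentFun (t.2.2.1.1, t.1.2) (t.2.2.2.1, t.2.1.2) (t.2.2.1.1, t.2.1.2) (t.2.2.2.1, t.1.2)
      (t.1.1, t.2.2.1.2) (t.2.1.1, t.2.2.2.2) (t.2.1.1, t.2.2.1.2) (t.1.1, t.2.2.2.2) u
  · simp only [Fintype.sum_prod_type (α₁ := Fin N × Fin N)]
    rfl
  · exact Fintype.sum_equiv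
      ⟨fun t => ((t.2.2.1.1, t.1.1), (t.2.2.2.1, t.2.1.1), (t.1.2, t.2.2.1.2), (t.2.1.2, t.2.2.2.2)),
        fun t => ((t.1.2, t.2.2.1.1), (t.2.1.2, t.2.2.2.1), (t.1.1, t.2.2.1.2),
          (t.2.1.1, t.2.2.2.2)), fun _ => rfl, fun _ => rfl⟩ _ _ fun _ => rfl

lemma sum_symm_coincidences :
    ∑ t : (Fin N × Fin N) × (Fin N × Fin N) × (Fin N × Fin N) × (Fin N × Fin N),
      (((if t.1.2 = t.2.1.2 then (1 : ℂ) else 0) + (if t.2.2.1.2 = t.2.2.2.2 then 1 else 0)) *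
        ((if t.1.1 = t.2.1.1 then 1 else 0) + (if t.2.2.1.1 = t.2.2.2.1 then 1 else 0)))
      = 4 * (N : ℂ) ^ 6 := by
  let F : Fin N × Fin N × Fin N × Fin N → ℂ := fun t =>
    (if t.1 = t.2.1 then 1 else 0) + (if t.2.2.1 = t.2.2.2 then 1 else 0)
  have hF : ∑ t, F t = 2 * (N : ℂ) ^ 3 := by
    have hexp : ∑ t, F t = ∑ a : Fin N, ∑ b : Fin N, ∑ c : Fin N, ∑ d : Fin N,
        ((if a = b then (1 : ℂ) else 0) + (if c = d then 1 else 0)) := by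
      simp only [Fintype.sum_prod_type]
      rfl
    rw [hexp]
    simp [Finset.sum_add_distrib]
    ring
  trans ∑ t : (Fin N × Fin N × Fin N × Fin N) × (Fin N × Fin N × Fin N × Fin N), F t.1 * F t.2
  · exact Fintype.sum_equiv
      ⟨fun t => ((t.1.2, t.2.1.2, t.2.2.1.2, t.2.2.2.2), (t.1.1, t.2.1.1, t.2.2.1.1, t.2.2.2.1)),
        fun t => ((t.2.1, t.1.1), (t.2.2.1, t.1.2.1), (t.2.2.2.1, t.1.2.2.1),
          (t.2.2.2.2, t.1.2.2.2)), fun _ => rfl, fun _ => rfl⟩ _ _ fun _ => rfl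
  · rw [Fintype.sum_prod_type]
    refine (Finset.sum_mul_sum Finset.univ Finset.univ F F).symm.trans ?_
    rw [hF]
    ring

/-- The Haar averages of the two purities add up to `4 / (N² + 1)`. -/
theorem integral_purity_add (hN : N ≠ 0)
    (μ : Measure (Matrix.unitaryGroup (Fin N × Fin N) ℂ)) [μ.IsHaarMeasure]
    [IsProbabilityMeasure μ] :
    ∫ u : Matrix.unitaryGroup (Fin N × Fin N) ℂ,
      ((rhoR N u * rhoR N u).trace + (rhoT N u * rhoT N u).trace) ∂μ
      = 4 / ((N : ℂ) ^ 2 + 1) := by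
  have : NeZero N := ⟨hN⟩
  simp only [trace_rhoR_sq_eq, trace_rhoT_sq_eq, ← mul_add]
  rw [integral_const_mul, integral_add
    (integrable_finsetSum _ fun _ _ => integrable_momentFun _ _ _ _ _ _ _ _ _)
    (integrable_finsetSum _ fun _ _ => integrable_momentFun _ _ _ _ _ _ _ _ _),
    integral_finsetSum _ fun _ _ => integrable_momentFun _ _ _ _ _ _ _ _ _,
    integral_finsetSum _ fun _ _ => integrable_momentFun _ _ _ _ _ _ _ _ _]
  change _ * (∑ t : (Fin N × Fin N) × (Fin N × Fin N) × (Fin N × Fin N) × (Fin N × Fin N),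
      moment μ (t.1.1, t.2.2.1.1) (t.2.1.1, t.2.2.2.1) (t.2.1.1, t.2.2.1.1) (t.1.1, t.2.2.2.1)
        (t.1.2, t.2.2.1.2) (t.2.1.2, t.2.2.2.2) (t.2.1.2, t.2.2.1.2) (t.1.2, t.2.2.2.2) +
    ∑ t : (Fin N × Fin N) × (Fin N × Fin N) × (Fin N × Fin N) × (Fin N × Fin N),
      moment μ (t.1.1, t.2.2.1.1) (t.2.1.1, t.2.2.2.1) (t.1.1, t.2.2.2.1) (t.2.1.1, t.2.2.1.1)
        (t.1.2, t.2.2.1.2) (t.2.1.2, t.2.2.2.2) (t.2.1.2, t.2.2.1.2) (t.1.2, t.2.2.2.2)) = _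
  have h3 : ∑ t : (Fin N × Fin N) × (Fin N × Fin N) × (Fin N × Fin N) × (Fin N × Fin N),
      moment μ (t.2.1.1, t.2.2.2.1) (t.1.1, t.2.2.1.1) (t.2.1.1, t.2.2.1.1) (t.1.1, t.2.2.2.1)
        (t.1.2, t.2.2.1.2) (t.2.1.2, t.2.2.2.2) (t.2.1.2, t.2.2.1.2) (t.1.2, t.2.2.2.2) =
    ∑ t : (Fin N × Fin N) × (Fin N × Fin N) × (Fin N × Fin N) × (Fin N × Fin N),
      moment μ (t.1.1, t.2.2.1.1) (t.2.1.1, t.2.2.2.1) (t.1.1, t.2.2.2.1) (t.2.1.1, t.2.2.1.1)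
        (t.1.2, t.2.2.1.2) (t.2.1.2, t.2.2.2.2) (t.2.1.2, t.2.2.1.2) (t.1.2, t.2.2.2.2) :=
    Fintype.sum_equiv
      ⟨fun t => ((t.2.1.1, t.1.2), (t.1.1, t.2.1.2), (t.2.2.2.1, t.2.2.1.2),
        (t.2.2.1.1, t.2.2.2.2)), fun t => ((t.2.1.1, t.1.2), (t.1.1, t.2.1.2),
        (t.2.2.2.1, t.2.2.1.2), (t.2.2.1.1, t.2.2.2.2)), fun _ => rfl, fun _ => rfl⟩
      _ _ fun _ => rfl
  have h4 : ∑ t : (Fin N × Fin N) × (Fin N × Fin N) × (Fin N × Fin N) × (Fin N × Fin N),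
      moment μ (t.2.1.1, t.2.2.2.1) (t.1.1, t.2.2.1.1) (t.1.1, t.2.2.2.1) (t.2.1.1, t.2.2.1.1)
        (t.1.2, t.2.2.1.2) (t.2.1.2, t.2.2.2.2) (t.2.1.2, t.2.2.1.2) (t.1.2, t.2.2.2.2) =
    ∑ t : (Fin N × Fin N) × (Fin N × Fin N) × (Fin N × Fin N) × (Fin N × Fin N),
      moment μ (t.1.1, t.2.2.1.1) (t.2.1.1, t.2.2.2.1) (t.2.1.1, t.2.2.1.1) (t.1.1, t.2.2.2.1)
        (t.1.2, t.2.2.1.2) (t.2.1.2, t.2.2.2.2) (t.2.1.2, t.2.2.1.2) (t.1.2, t.2.2.2.2) :=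
    Fintype.sum_equiv
      ⟨fun t => ((t.2.1.1, t.1.2), (t.1.1, t.2.1.2), (t.2.2.2.1, t.2.2.1.2),
        (t.2.2.1.1, t.2.2.2.2)), fun t => ((t.2.1.1, t.1.2), (t.1.1, t.2.1.2),
        (t.2.2.2.1, t.2.2.1.2), (t.2.2.1.1, t.2.2.2.2)), fun _ => rfl, fun _ => rfl⟩
      _ _ fun _ => rfl
  have hsum := Finset.sum_congr (rfl : (Finset.univ : Finset
      ((Fin N × Fin N) × (Fin N × Fin N) × (Fin N × Fin N) × (Fin N × Fin N))) = Finset.univ)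
    fun t _ => symm_moment_eq μ (t.1.1, t.2.2.1.1) (t.2.1.1, t.2.2.2.1) (t.2.1.1, t.2.2.1.1)
      (t.1.1, t.2.2.2.1) (t.1.2, t.2.2.1.2) (t.2.1.2, t.2.2.2.2) (t.2.1.2, t.2.2.1.2)
      (t.1.2, t.2.2.2.2)
  have hand {α : Type} [DecidableEq α] (x y : α) :
      (if x = y ∧ y = x then (1 : ℂ) else 0) = if x = y then 1 else 0 := by
    simp [eq_comm]
  simp only [Finset.sum_add_distrib] at hsum
  rw [h3, h4] at hsum
  simp only [Prod.mk.injEq, and_true, true_and, hand, mul_assoc] at hsum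
  rw [← Finset.mul_sum, sum_symm_coincidences, Fintype.card_prod, Fintype.card_fin] at hsum
  push_cast at hsum
  have hN' : (N : ℂ) ≠ 0 := Nat.cast_ne_zero.2 hN
  have hN2 : (N : ℂ) ^ 2 + 1 ≠ 0 := by exact_mod_cast (Nat.succ_ne_zero (N ^ 2))
  have hr : (2 : ℂ) / (N * (N * ((N : ℂ) * N + 1))) * (4 * (N : ℂ) ^ 6) =
      2 * ((N : ℂ) ^ 4 * (4 / ((N : ℂ) ^ 2 + 1))) := by
    rw [← sq]
    field_simp
  rw [inv_mul_eq_iff_eq_mul₀ (pow_ne_zero 4 hN')]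
  linear_combination (hsum + hr) / 2

lemma integrable_purities (μ : Measure (Matrix.unitaryGroup (Fin N × Fin N) ℂ))
    [IsFiniteMeasure μ] : Integrable (fun u : Matrix.unitaryGroup (Fin N × Fin N) ℂ =>
      ((rhoR N u * rhoR N u).trace + (rhoT N u * rhoT N u).trace)) μ := by
  simp only [trace_rhoR_sq_eq, trace_rhoT_sq_eq]
  exact ((integrable_finsetSum _ fun _ _ => integrable_momentFun ..).const_mul _).add
    ((integrable_finsetSum _ fun _ _ => integrable_momentFun ..).const_mul _)

end Purities

/-- The Haar average of the entangling power over `U(N²)` equals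
`(N-1)²/(N²+1)`. -/
theorem entangling_power_haar_average (N : ℕ) (hN : 2 ≤ N)
    (μ : Measure (Matrix.unitaryGroup (Fin N × Fin N) ℂ)) [μ.IsHaarMeasure]
    [IsProbabilityMeasure μ] :
    (∫ u : Matrix.unitaryGroup (Fin N × Fin N) ℂ,
        ep N (u : Matrix (Fin N × Fin N) (Fin N × Fin N) ℂ) ∂μ)
      = ((N : ℝ) - 1) ^ 2 / ((N : ℝ) ^ 2 + 1) := by
  have hN0 : (N : ℝ) ≠ 0 := Nat.cast_ne_zero.2 (by omega)
  have hint := integrable_purities μ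
  have hep (u : Matrix.unitaryGroup (Fin N × Fin N) ℂ) :
      ep N (u : Matrix (Fin N × Fin N) (Fin N × Fin N) ℂ) =
        (N : ℝ) ^ 2 / ((N : ℝ) + 1) ^ 2 * ((2 - ((N : ℝ) ^ 2 - 1) / (N : ℝ) ^ 2) -
          RCLike.re ((rhoR N u * rhoR N u).trace + (rhoT N u * rhoT N u).trace)) := by
    simp only [ep, Xpur, Ypur, map_add, RCLike.re_eq_complex_re]
    ring
  have hre : RCLike.re (4 / ((N : ℂ) ^ 2 + 1)) = 4 / ((N : ℝ) ^ 2 + 1) := by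
    rw [show (4 / ((N : ℂ) ^ 2 + 1)) = ((4 / ((N : ℝ) ^ 2 + 1) : ℝ) : ℂ) by push_cast; rfl]
    exact Complex.ofReal_re _
  simp only [hep]
  rw [integral_const_mul, integral_sub (integrable_const _) hint.re, integral_re hint,
    integral_purity_add (by omega) μ, hre]
  simp only [integral_const, probReal_univ, smul_eq_mul, one_mul]
  have h1 : (N : ℝ) + 1 ≠ 0 := by positivity
  have h2 : (N : ℝ) ^ 2 + 1 ≠ 0 := by positivity
  field_simp
  ring
end
end

section
/- Let N ≥ 1 and let n ≥ 1 be an integer. With V drawn from the Haar probability measure on the unitary group U(N), the average form factor satisfies ∫_{U(N)} |tr(V^n)|² dV = n if n ≤ N, and ∫_{U(N)} |tr(V^n)|² dV = N if n > N. -/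
open Matrix MeasureTheory
open scoped Kronecker

noncomputable section

section Newton

open Finset.HasAntidiagonal (antidiagonal mem_antidiagonal)

variable {R : Type*} [CommRing R]

/-- The coefficient `ε ^ (k - 1)` of the `k`-th power sum in Newton's identities,
extended by `0` to `k = 0`. -/
def newtonWeight (ε : ℤ) : ℕ → ℤ
  | 0 => 0
  | k + 1 => ε ^ k

lemma newtonWeight_zero (ε : ℤ) : newtonWeight ε 0 = 0 := rfl

lemma newtonWeight_succ (ε : ℤ) (k : ℕ) : newtonWeight ε (k + 1) = ε ^ k := rfl

/-- The sequence `s` is determined by the power sums `p` through Newton's identities; `ε = 1` gives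
the complete homogeneous functions and `ε = -1` the elementary symmetric functions. -/
def IsNewtonSeq (ε : ℤ) (p s : ℕ → R) : Prop :=
  s 0 = 1 ∧ ∀ n : ℕ, (n : R) * s n =
    ∑ x ∈ antidiagonal n, (newtonWeight ε x.1 : R) * p x.1 * s x.2

open PowerSeries in
/-- The Euler operator `X d/dX` on power series. -/
def eulerOp (f : PowerSeries R) : PowerSeries R := X * d⁄dX R f

open PowerSeries in
lemma coeff_eulerOp (f : PowerSeries R) (n : ℕ) :
    coeff n (eulerOp f) = n * coeff n f := by
  cases n with
  | zero => simp [eulerOp]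
  | succ n => rw [eulerOp, coeff_succ_X_mul, coeff_derivative]; push_cast; ring

lemma eulerOp_mul (f g : PowerSeries R) : eulerOp (f * g) = eulerOp f * g + f * eulerOp g := by
  simp only [eulerOp, Derivation.leibniz, smul_eq_mul]; ring

lemma sum_antidiagonal_newtonWeight_mul {ε : ℤ} (hε : ε * ε = 1) (s : ℕ) :
    ∑ x ∈ antidiagonal s, newtonWeight ε x.1 * newtonWeight ε x.2 =
      ε * (s - 1) * newtonWeight ε s := by
  cases s with
  | zero => simp [newtonWeight]
  | succ s =>
    rw [Finset.Nat.sum_antidiagonal_succ]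
    cases s with
    | zero => simp [newtonWeight]
    | succ s =>
      rw [Finset.Nat.sum_antidiagonal_succ']
      have : ∀ x ∈ antidiagonal s, newtonWeight ε (x.1 + 1) * newtonWeight ε (x.2 + 1) =
          ε ^ s := by
        intro x hx
        rw [← mem_antidiagonal.mp hx, pow_add]; rfl
      rw [Finset.sum_congr rfl this]
      simp only [newtonWeight, Finset.sum_const, Finset.Nat.card_antidiagonal]
      push_cast
      simp only [nsmul_eq_mul, pow_succ]
      push_cast
      linear_combination (-(s + 1) * ε ^ s) * hε

lemma newtonWeight_mul_sum_range (ε : ℤ) (p : ℕ → R) (k : ℕ) :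
    (newtonWeight ε k : R) * ∑ a ∈ Finset.range k, p a * p (k - a) =
      p 0 * (newtonWeight ε k * p k) + ε * ∑ x ∈ antidiagonal k,
        (newtonWeight ε x.1 * p x.1) * (newtonWeight ε x.2 * p x.2) := by
  cases k with
  | zero => simp [newtonWeight]
  | succ k =>
    rw [Finset.sum_range_succ', Finset.Nat.sum_antidiagonal_succ]
    cases k with
    | zero => simp [newtonWeight, mul_comm]
    | succ k =>
      rw [Finset.Nat.sum_antidiagonal_succ',
        Finset.Nat.sum_antidiagonal_eq_sum_range_succ_mk]
      have : ∀ a ∈ Finset.range (k + 1),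
          ((newtonWeight ε (a + 1) : R) * p (a + 1)) *
            (newtonWeight ε (k - a + 1) * p (k - a + 1)) =
          (ε : R) ^ k * (p (a + 1) * p (k + 1 + 1 - (a + 1))) := by
        intro a ha
        have ha' : a ≤ k := by simpa [Nat.lt_succ_iff] using ha
        have h1 : k + 1 + 1 - (a + 1) = k - a + 1 := by omega
        have h2 : (ε : R) ^ k = ε ^ a * ε ^ (k - a) := by rw [← pow_add]; congr 1; omega
        rw [h1, h2]; simp only [newtonWeight]; push_cast; ring
      simp only [Finset.sum_congr rfl this, ← Finset.mul_sum]
      simp only [newtonWeight]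
      push_cast
      ring

lemma IsNewtonSeq.eulerOp_mk {ε : ℤ} {p s : ℕ → R} (hs : IsNewtonSeq ε p s) :
    eulerOp (PowerSeries.mk s) =
      PowerSeries.mk (fun k => (newtonWeight ε k : R) * p k) * PowerSeries.mk s := by
  ext n
  rw [coeff_eulerOp, PowerSeries.coeff_mul]
  simpa using hs.2 n

/-- The Casimir eigenvalue identity for the elementary and complete homogeneous functions. -/
lemma IsNewtonSeq.laplacian {ε : ℤ} (hε : ε * ε = 1) {p s : ℕ → R} (hs : IsNewtonSeq ε p s)
    (j : ℕ) :
    ∑ x ∈ antidiagonal j, (newtonWeight ε x.1 : R) *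
      (∑ y ∈ antidiagonal x.2, (newtonWeight ε y.1 : R) * s y.2 * p (x.1 + y.1) +
        s x.2 * ∑ a ∈ Finset.range x.1, p a * p (x.1 - a)) =
      j * (p 0 + ε * (j - 1)) * s j := by
  set Q : PowerSeries R := PowerSeries.mk (fun k => (newtonWeight ε k : R) * p k) with hQ
  set S : PowerSeries R := PowerSeries.mk s with hS
  have key : ∑ x ∈ antidiagonal j, (newtonWeight ε x.1 : R) *
      (∑ y ∈ antidiagonal x.2, (newtonWeight ε y.1 : R) * s y.2 * p (x.1 + y.1) +
        s x.2 * ∑ a ∈ Finset.range x.1, p a * p (x.1 - a)) =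
      PowerSeries.coeff j (PowerSeries.C (ε : R) * (eulerOp Q - Q) * S +
        (PowerSeries.C (p 0) * Q + PowerSeries.C (ε : R) * (Q * Q)) * S) := by
    simp only [mul_add, Finset.sum_add_distrib, map_add]
    congr 1
    · have : ∀ x ∈ antidiagonal j,
          PowerSeries.coeff x.1 (PowerSeries.C (ε : R) * (eulerOp Q - Q)) *
            PowerSeries.coeff x.2 S =
          ∑ y ∈ antidiagonal x.1,
            (newtonWeight ε y.1 : R) * newtonWeight ε y.2 * p (y.1 + y.2) * s x.2 := by
        intro x _
        have h1 : ∀ y ∈ antidiagonal x.1,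
            (newtonWeight ε y.1 : R) * newtonWeight ε y.2 * p (y.1 + y.2) * s x.2 =
            ((newtonWeight ε y.1 * newtonWeight ε y.2 : ℤ) : R) * (p x.1 * s x.2) := by
          intro y hy
          rw [mem_antidiagonal.mp hy]; push_cast; ring
        rw [Finset.sum_congr rfl h1, ← Finset.sum_mul, ← Int.cast_sum,
          sum_antidiagonal_newtonWeight_mul hε,
          PowerSeries.coeff_C_mul, map_sub, coeff_eulerOp]
        simp only [hQ, hS, PowerSeries.coeff_mk]
        push_cast; ring
      rw [PowerSeries.coeff_mul, Finset.sum_congr rfl this]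
      simp only [Finset.mul_sum]
      rw [Finset.sum_sigma', Finset.sum_sigma']
      refine Finset.sum_nbij' (fun x => ⟨(x.1.1 + x.2.1, x.2.2), (x.1.1, x.2.1)⟩)
        (fun x => ⟨(x.2.1, x.2.2 + x.1.2), (x.2.2, x.1.2)⟩) ?_ ?_ ?_ ?_ ?_
      · rintro ⟨⟨a, b⟩, ⟨c, d⟩⟩ h; simp at h ⊢; omega
      · rintro ⟨⟨a, b⟩, ⟨c, d⟩⟩ h; simp at h ⊢; omega
      · rintro ⟨⟨a, b⟩, ⟨c, d⟩⟩ h; simp at h ⊢; omega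
      · rintro ⟨⟨a, b⟩, ⟨c, d⟩⟩ h; simp at h ⊢; omega
      · rintro ⟨⟨a, b⟩, ⟨c, d⟩⟩ h; ring
    · rw [PowerSeries.coeff_mul]
      refine Finset.sum_congr rfl fun x _ => ?_
      rw [← mul_assoc, mul_right_comm, newtonWeight_mul_sum_range, map_add,
        PowerSeries.coeff_C_mul, PowerSeries.coeff_C_mul, PowerSeries.coeff_mul]
      simp only [hQ, hS, PowerSeries.coeff_mk]
  have h1 : eulerOp S = Q * S := hs.eulerOp_mk
  have h2 : eulerOp (eulerOp S) = eulerOp Q * S + Q * (Q * S) := by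
    rw [h1, eulerOp_mul, h1]
  have h3 : PowerSeries.C (ε : R) * (eulerOp Q - Q) * S +
        (PowerSeries.C (p 0) * Q + PowerSeries.C (ε : R) * (Q * Q)) * S =
      PowerSeries.C (ε : R) * (eulerOp (eulerOp S) - eulerOp S) +
        PowerSeries.C (p 0) * eulerOp S := by
    rw [h2, h1]; ring
  rw [key, h3, map_add, PowerSeries.coeff_C_mul, PowerSeries.coeff_C_mul, map_sub]
  simp only [coeff_eulerOp, hS, PowerSeries.coeff_mk]
  ring

lemma newtonWeight_one_eq (l : ℕ) : newtonWeight 1 l = 1 - if l = 0 then 1 else 0 := by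
  cases l <;> simp [newtonWeight]

lemma newtonWeight_neg_one_eq (k : ℕ) :
    newtonWeight (-1) k = (if k = 0 then 1 else 0) - (-1) ^ k := by
  cases k <;> simp [newtonWeight, pow_succ]

lemma sum_antidiagonal_ite_fst_eq_zero {M : Type*} [AddCommMonoid M] (n : ℕ) (f : ℕ × ℕ → M) :
    ∑ x ∈ antidiagonal n, (if x.1 = 0 then f x else 0) = f (0, n) := by
  rw [Finset.sum_eq_single (0, n)]
  · simp
  · rintro ⟨a, b⟩ h hne
    simp at h ⊢
    rintro rfl
    simp at h; exact absurd (by simp [h]) hne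
  · simp

/-- The cross term `∑ tr (∇eⱼ ∇hₘ)` of the Laplacian of `eⱼ hₘ`. -/
def crossTerm (p e h : ℕ → R) (j m : ℕ) : R :=
  ∑ x ∈ antidiagonal j, ∑ y ∈ antidiagonal m,
    (newtonWeight (-1) x.1 : R) * newtonWeight 1 y.1 * p (x.1 + y.1) * (e x.2 * h y.2)

lemma crossTerm_add_crossTerm {p e h : ℕ → R} (he : IsNewtonSeq (-1) p e)
    (hh : IsNewtonSeq 1 p h) (j m : ℕ) :
    crossTerm p e h j (m + 1) + crossTerm p e h (j + 1) m =
      (m + 1) * (e j * h (m + 1)) - (j + 1) * (e (j + 1) * h m) := by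
  have e1 := he.2 (j + 1)
  have h1 := hh.2 (m + 1)
  rw [Finset.Nat.sum_antidiagonal_succ] at e1 h1
  simp only [newtonWeight_zero, newtonWeight_succ, one_pow, Int.cast_zero, Int.cast_one, zero_mul,
    zero_add, one_mul]
    at e1 h1
  push_cast at e1 h1
  simp only [crossTerm, Finset.Nat.sum_antidiagonal_succ]
  simp only [newtonWeight_zero, newtonWeight_succ, one_pow, Int.cast_zero, Int.cast_one, zero_mul,
    zero_add, mul_one,
    mul_zero, Finset.sum_const_zero]
  rw [← Finset.sum_add_distrib]
  have : ∀ x ∈ antidiagonal j,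
      (∑ y ∈ antidiagonal m, (newtonWeight (-1) x.1 : R) * p (x.1 + (y.1 + 1)) *
          (e x.2 * h y.2) +
        ∑ y ∈ antidiagonal m, (((-1) ^ x.1 : ℤ) : R) * newtonWeight 1 y.1 *
          p (x.1 + 1 + y.1) * (e x.2 * h y.2)) =
      (if x.1 = 0 then ∑ y ∈ antidiagonal m, p (x.1 + 1 + y.1) * (e x.2 * h y.2) else 0) -
        (-1) ^ x.1 * (p (x.1 + 1) * (e x.2 * h m)) := by
    intro x _
    rw [← Finset.sum_add_distrib]
    have h2 := sum_antidiagonal_ite_fst_eq_zero m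
      (fun y => (-1) ^ x.1 * (p (x.1 + 1 + y.1) * (e x.2 * h y.2)))
    simp only [add_zero] at h2
    rw [← h2]
    have h3 : (if x.1 = 0 then ∑ y ∈ antidiagonal m,
        p (x.1 + 1 + y.1) * (e x.2 * h y.2) else 0) =
        ∑ y ∈ antidiagonal m, if x.1 = 0 then
        p (x.1 + 1 + y.1) * (e x.2 * h y.2) else 0 := by
      split_ifs <;> simp
    rw [h3, ← Finset.sum_sub_distrib]
    refine Finset.sum_congr rfl fun y _ => ?_
    rw [newtonWeight_one_eq, newtonWeight_neg_one_eq,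
      show x.1 + (y.1 + 1) = x.1 + 1 + y.1 by ring]
    push_cast
    split_ifs <;> ring
  rw [Finset.sum_congr rfl this, Finset.sum_sub_distrib, sum_antidiagonal_ite_fst_eq_zero]
  rw [mul_left_comm, h1, ← mul_assoc _ (e (j + 1)), e1, Finset.mul_sum, Finset.sum_mul]
  congr 1
  · refine Finset.sum_congr rfl fun y _ => ?_
    rw [show 0 + 1 + y.1 = y.1 + 1 by ring]; ring
  · refine Finset.sum_congr rfl fun y _ => ?_
    ring

/-- `∑ (-1)ʲ eⱼ tʲ` and `∑ hₘ tᵐ`. -/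
lemma eulerOp_mk_alternating {p e : ℕ → R} (he : IsNewtonSeq (-1) p e) :
    eulerOp (PowerSeries.mk fun j => (-1) ^ j * e j) =
      -(PowerSeries.mk (fun k => (newtonWeight 1 k : R) * p k) *
        PowerSeries.mk fun j => (-1) ^ j * e j) := by
  ext n
  rw [coeff_eulerOp, map_neg, PowerSeries.coeff_mul, PowerSeries.coeff_mk, mul_left_comm, he.2,
    Finset.mul_sum, ← Finset.sum_neg_distrib]
  refine Finset.sum_congr rfl fun x hx => ?_
  simp only [PowerSeries.coeff_mk]
  rw [← mem_antidiagonal.mp hx, pow_add]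
  rcases x with ⟨_ | k, l⟩
  · simp [newtonWeight]
  · simp only [newtonWeight]
    push_cast
    have : ((-1 : R) ^ k) * (-1) ^ k = 1 := by rw [← mul_pow]; simp
    rw [pow_succ]
    linear_combination (-((-1) ^ l * p (k + 1) * e l)) * this

lemma natCast_mul_sum_alternating {p e h : ℕ → R} (he : IsNewtonSeq (-1) p e)
    (hh : IsNewtonSeq 1 p h) (n : ℕ) :
    (n : R) * ∑ x ∈ antidiagonal n, (-1) ^ x.1 * e x.1 * h x.2 = 0 := by
  have := congrArg (PowerSeries.coeff n)
    (eulerOp_mul (PowerSeries.mk fun j => (-1) ^ j * e j) (PowerSeries.mk h))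
  rw [eulerOp_mk_alternating he, hh.eulerOp_mk, coeff_eulerOp, PowerSeries.coeff_mul] at this
  simp only [PowerSeries.coeff_mk] at this
  rw [this, ← map_zero (PowerSeries.coeff (R := R) n)]
  congr 1; ring

lemma sum_alternating_eq_one [IsAddTorsionFree R] {p e h : ℕ → R}
    (he : IsNewtonSeq (-1) p e) (hh : IsNewtonSeq 1 p h) :
    (PowerSeries.mk fun j => (-1) ^ j * e j) * PowerSeries.mk h = 1 := by
  ext n
  rw [PowerSeries.coeff_mul, PowerSeries.coeff_one]
  simp only [PowerSeries.coeff_mk]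
  split_ifs with hn
  · subst hn; simp [he.1, hh.1]
  · have := natCast_mul_sum_alternating he hh n
    rw [← nsmul_eq_mul] at this
    exact (smul_eq_zero.mp this).resolve_left hn

lemma powerSum_eq_sum [IsAddTorsionFree R] {p e h : ℕ → R}
    (he : IsNewtonSeq (-1) p e) (hh : IsNewtonSeq 1 p h) {n : ℕ} (hn : n ≠ 0) :
    p n = -∑ x ∈ antidiagonal n, (x.1 : R) * ((-1) ^ x.1 * (e x.1 * h x.2)) := by
  have h1 := sum_alternating_eq_one he hh
  have h2 : eulerOp (PowerSeries.mk fun j => (-1) ^ j * e j) * PowerSeries.mk h =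
      -PowerSeries.mk (fun k => (newtonWeight 1 k : R) * p k) := by
    rw [eulerOp_mk_alternating he, neg_mul, mul_assoc, h1, mul_one]
  have h3 := congrArg (PowerSeries.coeff n) h2
  rw [PowerSeries.coeff_mul, map_neg] at h3
  simp only [coeff_eulerOp, PowerSeries.coeff_mk] at h3
  obtain ⟨k, rfl⟩ := Nat.exists_eq_succ_of_ne_zero hn
  simp only [newtonWeight_succ, one_pow, Int.cast_one, one_mul] at h3
  rw [← neg_eq_iff_eq_neg, ← h3]
  exact Finset.sum_congr rfl fun x _ => by ring

/-- The contraction `tr (Vᵏ ∇(eⱼ hₘ)) + eⱼ hₘ ∑ₐ pₐ pₖ₋ₐ` occurring in the loop equations. -/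
def loopTerm (p e h : ℕ → R) (k j m : ℕ) : R :=
  ∑ x ∈ antidiagonal j, (newtonWeight (-1) x.1 : R) * e x.2 * p (k + x.1) * h m +
    ∑ y ∈ antidiagonal m, (newtonWeight 1 y.1 : R) * h y.2 * p (k + y.1) * e j +
    e j * h m * ∑ a ∈ Finset.range k, p a * p (k - a)

/-- The loop equations satisfied by the functionals `φ n f = ∫ f * conj (p n)`. -/
def LoopEquations [Algebra ℂ R] (p e h : ℕ → R) (φ : ℕ → R →ₗ[ℂ] ℂ) : Prop :=
  ∀ n k j m, 1 ≤ k → k ≤ n → φ n (loopTerm p e h k j m) = n * φ (n - k) (e j * h m)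

lemma sum_newtonWeight_mul_loopTerm {p e h : ℕ → R} (he : IsNewtonSeq (-1) p e) (j m : ℕ) :
    ∑ x ∈ antidiagonal j, (newtonWeight (-1) x.1 : R) * loopTerm p e h x.1 x.2 m =
      j * (p 0 - (j - 1)) * (e j * h m) + crossTerm p e h j m := by
  have h1 := he.laplacian (by norm_num) j
  push_cast at h1
  have h2 : (j : R) * (p 0 - (j - 1)) * (e j * h m) = j * (p 0 + -1 * (j - 1)) * e j * h m := by
    ring
  rw [h2, ← h1, Finset.sum_mul, crossTerm, ← Finset.sum_add_distrib]
  refine Finset.sum_congr rfl fun x _ => ?_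
  simp only [loopTerm, ← Finset.sum_mul]
  have h3 : ∑ y ∈ antidiagonal m, (newtonWeight (-1) x.1 : R) * newtonWeight 1 y.1 *
      p (x.1 + y.1) * (e x.2 * h y.2) = newtonWeight (-1) x.1 *
      ((∑ y ∈ antidiagonal m, (newtonWeight 1 y.1 : R) * h y.2 * p (x.1 + y.1)) * e x.2) := by
    rw [Finset.sum_mul, Finset.mul_sum]
    exact Finset.sum_congr rfl fun y _ => by ring
  rw [h3]; ring

lemma sum_newtonWeight_mul_loopTerm_zero {p e h : ℕ → R} (he : IsNewtonSeq (-1) p e)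
    (hh : IsNewtonSeq 1 p h) (m : ℕ) :
    ∑ x ∈ antidiagonal m, (newtonWeight 1 x.1 : R) * loopTerm p e h x.1 0 x.2 =
      m * (p 0 + (m - 1)) * h m := by
  have h1 := hh.laplacian (by norm_num) m
  push_cast at h1
  rw [one_mul] at h1
  rw [← h1]
  refine Finset.sum_congr rfl fun x _ => ?_
  simp [loopTerm, newtonWeight_zero, he.1]

lemma LoopEquations.map_sum [Algebra ℂ R] {p e h : ℕ → R} {φ : ℕ → R →ₗ[ℂ] ℂ}
    (hφ : LoopEquations p e h φ) (ε : ℤ) (n s : ℕ) (hs : s ≤ n) (j m : ℕ → ℕ) :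
    φ n (∑ x ∈ antidiagonal s, (newtonWeight ε x.1 : R) * loopTerm p e h x.1 (j x.2) (m x.2)) =
      n * ∑ x ∈ antidiagonal s, (newtonWeight ε x.1 : ℂ) *
        φ (n - x.1) (e (j x.2) * h (m x.2)) := by
  rw [_root_.map_sum, Finset.mul_sum]
  refine Finset.sum_congr rfl fun x hx => ?_
  rcases Nat.eq_zero_or_pos x.1 with h0 | h0
  · simp [h0, newtonWeight_zero]
  · rw [← zsmul_eq_mul, map_zsmul, hφ n x.1 _ _ h0
      (by have := mem_antidiagonal.mp hx; omega), zsmul_eq_mul]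
    ring

section Moments

variable [Algebra ℂ R] {p e h : ℕ → R} {φ : ℕ → R →ₗ[ℂ] ℂ} {N : ℕ}

lemma LoopEquations.map_complete (hφ : LoopEquations p e h φ) (he : IsNewtonSeq (-1) p e)
    (hh : IsNewtonSeq 1 p h) (hN : 1 ≤ N) (hp : p 0 = N) (h0 : φ 0 1 = N) (n : ℕ) :
    φ (n + 1) (h (n + 1)) = 1 := by
  induction n using Nat.strong_induction_on with
  | _ n ih =>
    have h1 := hφ.map_sum 1 (n + 1) (n + 1) le_rfl (fun _ => 0) id
    simp only [id, sum_newtonWeight_mul_loopTerm_zero he hh, hp, he.1, one_mul] at h1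
    have h2 : ((n + 1 : ℕ) : R) * (N + ((n + 1 : ℕ) - 1)) * h (n + 1) =
        ((n + 1) * (N + n)) • h (n + 1) := by
      rw [nsmul_eq_mul]; push_cast; ring
    have h3 : ∑ x ∈ antidiagonal (n + 1), ((newtonWeight 1 x.1 : ℤ) : ℂ) *
        φ (n + 1 - x.1) (h x.2) = N + n := by
      have h4 : ∀ x ∈ antidiagonal n, (((newtonWeight 1 (x.1 + 1) : ℤ) : ℂ) *
          φ (n + 1 - (x.1 + 1)) (h x.2)) = 1 + if x.2 = 0 then (N : ℂ) - 1 else 0 := by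
        rintro ⟨a, b⟩ hx
        have hab : a + b = n := mem_antidiagonal.mp hx
        have : n + 1 - (a + 1) = b := by omega
        simp only [this, newtonWeight_succ, one_pow, Int.cast_one, one_mul]
        rcases b with _ | b
        · simp [hh.1, h0]
        · rw [ih b (by omega)]; simp
      have h6 := sum_antidiagonal_ite_fst_eq_zero n fun _ => (N : ℂ) - 1
      rw [← Finset.Nat.sum_antidiagonal_swap] at h6
      simp only [Prod.fst_swap] at h6
      rw [Finset.Nat.sum_antidiagonal_succ, Finset.sum_congr rfl h4, Finset.sum_add_distrib, h6]
      simp [newtonWeight_zero, add_comm]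
    rw [h2, map_nsmul, h3, nsmul_eq_mul] at h1
    have h5 : ((n + 1 : ℕ) : ℂ) * (N + n) ≠ 0 := by
      have : (n + 1) * (N + n) ≠ 0 := by positivity
      exact_mod_cast this
    refine mul_left_cancel₀ h5 ?_
    push_cast at h1 ⊢
    linear_combination h1

lemma LoopEquations.recursion (hφ : LoopEquations p e h φ) (he : IsNewtonSeq (-1) p e)
    (hh : IsNewtonSeq 1 p h) (hp : p 0 = N) (j m : ℕ) :
    ((j : ℂ) * (N - j + 1) + m + 1) * φ (j + m + 1) (e j * h (m + 1)) +
      (j + 1) * (N - j - 1) * φ (j + m + 1) (e (j + 1) * h m) =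
    (j + m + 1) * (∑ x ∈ antidiagonal j, (newtonWeight (-1) x.1 : ℂ) *
        φ (x.2 + m + 1) (e x.2 * h (m + 1)) +
      ∑ x ∈ antidiagonal (j + 1), (newtonWeight (-1) x.1 : ℂ) *
        φ (x.2 + m) (e x.2 * h m)) := by
  have h1 := hφ.map_sum (-1) (j + m + 1) j (by omega) id (fun _ => m + 1)
  have h2 := hφ.map_sum (-1) (j + m + 1) (j + 1) (by omega) id (fun _ => m)
  simp only [id, sum_newtonWeight_mul_loopTerm he] at h1 h2
  have h3 : ∀ x ∈ antidiagonal j, ((newtonWeight (-1) x.1 : ℤ) : ℂ) *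
      φ (x.2 + m + 1) (e x.2 * h (m + 1)) = ((newtonWeight (-1) x.1 : ℤ) : ℂ) *
      φ (j + m + 1 - x.1) (e x.2 * h (m + 1)) := by
    intro x hx
    have : x.1 + x.2 = j := mem_antidiagonal.mp hx
    congr 3; omega
  have h4 : ∀ x ∈ antidiagonal (j + 1), ((newtonWeight (-1) x.1 : ℤ) : ℂ) *
      φ (x.2 + m) (e x.2 * h m) = ((newtonWeight (-1) x.1 : ℤ) : ℂ) *
      φ (j + m + 1 - x.1) (e x.2 * h m) := by
    intro x hx
    have : x.1 + x.2 = j + 1 := mem_antidiagonal.mp hx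
    congr 3; omega
  rw [Finset.sum_congr rfl h3, Finset.sum_congr rfl h4]
  have h5 : ((j : ℂ) + m + 1) = ((j + m + 1 : ℕ) : ℂ) := by push_cast; ring
  rw [h5, mul_add (((j + m + 1 : ℕ)) : ℂ), ← h1, ← h2, ← map_add]
  have h6 : (j : R) * (p 0 - (j - 1)) * (e j * h (m + 1)) + crossTerm p e h j (m + 1) +
      (((j + 1 : ℕ) : R) * (p 0 - ((j + 1 : ℕ) - 1)) * (e (j + 1) * h m) +
        crossTerm p e h (j + 1) m) =
      ((j : ℂ) * (N - j + 1) + m + 1) • (e j * h (m + 1)) +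
        (((j : ℂ) + 1) * (N - j - 1)) • (e (j + 1) * h m) := by
    simp only [Algebra.smul_def, map_add, map_mul, map_sub, map_natCast, map_one]
    rw [hp]
    push_cast
    linear_combination crossTerm_add_crossTerm he hh j m
  rw [h6, map_add, map_smul, map_smul, smul_eq_mul, smul_eq_mul]

lemma LoopEquations.map_hook (hφ : LoopEquations p e h φ) (he : IsNewtonSeq (-1) p e)
    (hh : IsNewtonSeq 1 p h) (hp : p 0 = N) (h0 : φ 0 1 = N) (j m : ℕ) (hj : j < N) :
    φ (j + m + 1) (e j * h (m + 1)) = if j = 0 then 1 else 0 := by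
  induction j using Nat.strong_induction_on generalizing m with
  | _ j ih =>
    rcases j with _ | j
    · simpa [he.1] using hφ.map_complete he hh (by omega) hp h0 m
    have hsum : ∀ s m, s ≤ j + 1 → ∑ x ∈ antidiagonal s, ((newtonWeight (-1) x.1 : ℤ) : ℂ) *
        φ (x.2 + m + 1) (e x.2 * h (m + 1)) = newtonWeight (-1) s := by
      intro s m hs
      rw [Finset.sum_eq_single (s, 0)]
      · have := ih 0 (by omega) m (by omega)
        simp only [this, if_true, mul_one]
      · rintro ⟨a, b⟩ hx hne
        have hab : a + b = s := mem_antidiagonal.mp hx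
        rcases Nat.eq_zero_or_pos a with rfl | ha
        · simp [newtonWeight_zero]
        · simp only
          rw [ih b (by omega) m (by omega), if_neg, mul_zero]
          rintro rfl; exact hne (by simp at hab; simp [hab])
      · simp
    have h1 := hφ.recursion he hh hp j (m + 1)
    have h2 := hsum j (m + 1) (by omega)
    have h3 := hsum (j + 1) m le_rfl
    simp only [← add_assoc] at h1 h2 h3
    rw [h2, h3, show j + m + 1 + 1 = j + (m + 1) + 1 by ring, ih j (by omega) (m + 1) (by omega)] at h1
    have h4 : ((j : ℂ) + 1) * (N - j - 1) ≠ 0 := by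
      have e1 : (j : ℂ) + 1 ≠ 0 := by exact_mod_cast Nat.succ_ne_zero j
      refine mul_ne_zero e1 ?_
      rw [sub_sub, sub_ne_zero]
      have : N ≠ j + 1 := by omega
      exact_mod_cast this
    rw [if_neg (by omega), show j + 1 + m + 1 = j + (m + 1) + 1 by ring]
    refine (mul_eq_zero.mp ?_).resolve_left h4
    rcases j with _ | j
    · simp only [newtonWeight] at h1
      push_cast at h1
      push_cast
      linear_combination h1
    · simp [newtonWeight, pow_succ] at h1 ⊢
      exact h1

/-- The loop equations determine the second moment of the power sums. -/
theorem LoopEquations.map_powerSum [IsAddTorsionFree R] (hφ : LoopEquations p e h φ)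
    (he : IsNewtonSeq (-1) p e) (hh : IsNewtonSeq 1 p h) (hN : 1 ≤ N) (hp : p 0 = N)
    (h0 : φ 0 1 = N) (hvan : ∀ j, N < j → e j = 0) {n : ℕ} (hn : 1 ≤ n) :
    φ n (p n) = (min n N : ℕ) := by
  set M := min n N with hM
  have hsum : ∀ f : ℕ → ℂ, ∑ x ∈ antidiagonal n, f x.1 * φ n (e x.1 * h x.2) =
      f 0 + f M * φ n (e M * h (n - M)) := by
    intro f
    have hMn : M ≤ n := min_le_left _ _
    rw [Finset.sum_eq_add_of_mem (0, n) (M, n - M)]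
    · congr 1
      obtain ⟨m, rfl⟩ : ∃ m, n = m + 1 := ⟨n - 1, by omega⟩
      have := hφ.map_hook he hh hp h0 0 m (by omega)
      simp only [zero_add, if_true] at this
      simp only [this, mul_one]
    · simp
    · rw [mem_antidiagonal]; simp; omega
    · intro h; have := congrArg Prod.fst h; simp at this; omega
    · rintro ⟨a, b⟩ hx ⟨h1, h2⟩
      have hab : a + b = n := mem_antidiagonal.mp hx
      have ha0 : a ≠ 0 := by rintro rfl; exact h1 (by simp at hab; simp [hab])
      have haM : a ≠ M := by rintro rfl; exact h2 (by simp; omega)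
      rcases lt_or_ge N a with haN | haN
      · simp [hvan a haN]
      · obtain ⟨m, rfl⟩ : ∃ m, b = m + 1 := ⟨b - 1, by omega⟩
        have := hφ.map_hook he hh hp h0 a m (by omega)
        rw [if_neg ha0, show a + m + 1 = n by omega] at this
        simp [this]
  have hlin : ∀ g : ℕ → ℤ, φ n (∑ x ∈ antidiagonal n, (g x.1 : R) * (e x.1 * h x.2)) =
      ∑ x ∈ antidiagonal n, (g x.1 : ℂ) * φ n (e x.1 * h x.2) := by
    intro g
    rw [_root_.map_sum]
    refine Finset.sum_congr rfl fun x _ => ?_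
    rw [← zsmul_eq_mul, map_zsmul, zsmul_eq_mul]
  have h1 : ∑ x ∈ antidiagonal n, (((-1) ^ x.1 : ℤ) : R) * (e x.1 * h x.2) = 0 := by
    have := congrArg (PowerSeries.coeff n) (sum_alternating_eq_one he hh)
    rw [PowerSeries.coeff_mul, PowerSeries.coeff_one, if_neg (by omega)] at this
    rw [← this]
    refine Finset.sum_congr rfl fun x _ => ?_
    simp only [PowerSeries.coeff_mk]; push_cast; ring
  have h2 : p n = -∑ x ∈ antidiagonal n, ((x.1 * (-1) ^ x.1 : ℤ) : R) * (e x.1 * h x.2) := by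
    rw [powerSum_eq_sum he hh (by omega)]
    congr 1
    refine Finset.sum_congr rfl fun x _ => ?_
    push_cast; ring
  have h3 := hlin fun j => (-1) ^ j
  have h4 := hlin fun j => j * (-1) ^ j
  rw [hsum fun j => (((-1) ^ j : ℤ) : ℂ), h1, map_zero] at h3
  rw [hsum fun j => ((j * (-1) ^ j : ℤ) : ℂ)] at h4
  rw [h2, map_neg, h4]
  push_cast at h3 ⊢
  linear_combination (M : ℂ) * h3

end Moments

/-- The sequence determined by the power sums `p` through Newton's identities. -/
def newtonSeq [Algebra ℂ R] (ε : ℤ) (p : ℕ → R) : ℕ → R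
  | 0 => 1
  | n + 1 => ((n + 1 : ℕ) : ℂ)⁻¹ •
      ∑ i : Fin (n + 1), (newtonWeight ε (i + 1) : R) * p (i + 1) * newtonSeq ε p (n - i)

lemma isNewtonSeq_newtonSeq [Algebra ℂ R] (ε : ℤ) (p : ℕ → R) :
    IsNewtonSeq ε p (newtonSeq ε p) := by
  refine ⟨by rw [newtonSeq], fun n => ?_⟩
  rcases n with _ | n
  · simp [newtonWeight]
  · rw [newtonSeq, Finset.Nat.sum_antidiagonal_succ, newtonWeight_zero,
      Finset.Nat.sum_antidiagonal_eq_sum_range_succ_mk, Finset.sum_range, ← nsmul_eq_mul,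
      ← Nat.cast_smul_eq_nsmul ℂ, smul_inv_smul₀ (by exact_mod_cast Nat.succ_ne_zero n)]
    simp

lemma IsNewtonSeq.unique [IsAddTorsionFree R] {ε : ℤ} {p s t : ℕ → R} (hs : IsNewtonSeq ε p s)
    (ht : IsNewtonSeq ε p t) (n : ℕ) : s n = t n := by
  induction n using Nat.strong_induction_on with
  | _ n ih =>
    rcases n with _ | n
    · rw [hs.1, ht.1]
    · have h : ((n + 1 : ℕ) : R) * s (n + 1) = ((n + 1 : ℕ) : R) * t (n + 1) := by
        rw [hs.2, ht.2, Finset.Nat.sum_antidiagonal_succ, Finset.Nat.sum_antidiagonal_succ]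
        simp only [newtonWeight_zero, Int.cast_zero, zero_mul]
        congr 1
        refine Finset.sum_congr rfl fun x hx => ?_
        rw [ih x.2 (by have := mem_antidiagonal.mp hx; omega)]
      rw [← nsmul_eq_mul, ← nsmul_eq_mul] at h
      exact nsmul_right_injective (Nat.succ_ne_zero n) h

lemma isNewtonSeq_esymm {σ : Type*} [Fintype σ] (x : σ → R) :
    IsNewtonSeq (-1) (fun k => ∑ i, x i ^ k)
      fun j => MvPolynomial.aeval x (MvPolynomial.esymm σ R j) := by
  refine ⟨by simp, fun n => ?_⟩
  have h := congrArg (MvPolynomial.aeval x) (MvPolynomial.mul_esymm_eq_sum σ R n)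
  rw [map_mul, map_natCast, map_mul, map_sum] at h
  rw [h, Finset.mul_sum, Finset.sum_filter, ← Finset.Nat.sum_antidiagonal_swap]
  refine Finset.sum_congr rfl fun y hy => ?_
  have hy' := mem_antidiagonal.mp hy
  rcases y with ⟨_ | k, l⟩
  · simp at hy'; simp [newtonWeight, hy']
  · have h1 : l < n := by simp at hy'; omega
    have h2 : (-1 : R) ^ (n + 1) * (-1) ^ l = (-1) ^ k := by
      rw [← hy', ← pow_add, show k + 1 + l + 1 + l = k + 2 * (l + 1) by ring, pow_add, pow_mul]
      simp
    simp only [Prod.swap, h1, if_true, newtonWeight, map_mul, map_pow, map_neg, map_one,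
      MvPolynomial.psum, map_sum, MvPolynomial.aeval_X]
    push_cast
    rw [← h2]; ring

lemma IsNewtonSeq.eq_zero_of_card_lt [IsAddTorsionFree R] {σ : Type*} [Fintype σ] {x : σ → R}
    {e : ℕ → R} (he : IsNewtonSeq (-1) (fun k => ∑ i, x i ^ k) e) {j : ℕ}
    (hj : Fintype.card σ < j) : e j = 0 := by
  rw [he.unique (isNewtonSeq_esymm x) j, MvPolynomial.esymm, Finset.powersetCard_eq_empty.mpr]
  · simp
  · simpa using hj

end Newton

namespace Matrix

open Polynomial

variable {ι K : Type*} [Fintype ι] [DecidableEq ι] [Field K] [IsAlgClosed K]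

lemma card_roots_charpoly (A : Matrix ι ι K) : A.charpoly.roots.card = Fintype.card ι := by
  rw [← (IsAlgClosed.splits A.charpoly).natDegree_eq_card_roots, charpoly_natDegree_eq_dim]

lemma det_sub_scalar (A : Matrix ι ι K) (a : K) :
    (A - scalar ι a).det = (A.charpoly.roots.map fun l => l - a).prod := by
  have h1 : (A - scalar ι a).det = (-1) ^ Fintype.card ι * A.charpoly.eval a := by
    rw [eval_charpoly, ← det_neg, neg_sub]
  have h2 : A.charpoly.eval a = (A.charpoly.roots.map fun l => a - l).prod := by
    conv_lhs => rw [(IsAlgClosed.splits A.charpoly).eq_prod_roots_of_monic (charpoly_monic A)]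
    rw [eval_multiset_prod, Multiset.map_map]
    simp
  have h3 := Multiset.prod_map_neg (A.charpoly.roots.map fun l => a - l)
  rw [h1, h2, ← card_roots_charpoly A]
  rw [Multiset.map_map, Multiset.card_map] at h3
  rw [← h3]
  simp

lemma det_aeval (A : Matrix ι ι K) {f : K[X]} (hf : f.Monic) :
    (aeval A f).det = (A.charpoly.roots.map fun l => f.eval l).prod := by
  have key : ∀ s : Multiset K, (aeval A (s.map fun a => X - C a).prod).det =
      (A.charpoly.roots.map fun l => (s.map fun a => X - C a).prod.eval l).prod := by
    intro s
    induction s using Multiset.induction with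
    | empty => simp
    | cons a s ih =>
      simp only [Multiset.map_cons, Multiset.prod_cons, map_mul, det_mul, eval_mul,
        Multiset.prod_map_mul, ih]
      congr 1
      rw [map_sub, aeval_X, aeval_C]
      simp only [eval_sub, eval_X, eval_C]
      exact det_sub_scalar A a
  rw [(IsAlgClosed.splits f).eq_prod_roots_of_monic hf]
  exact key _

lemma charpoly_pow_eq (A : Matrix ι ι K) {k : ℕ} (hk : k ≠ 0) :
    (A ^ k).charpoly = ((A.charpoly.roots.map (· ^ k)).map fun a => X - C a).prod := by
  refine Polynomial.funext fun t => ?_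
  have h1 := det_aeval A (monic_X_pow_sub_C t hk)
  have h2 : aeval A (X ^ k - C t) = -(scalar ι t - A ^ k) := by
    rw [map_sub, map_pow, aeval_X, aeval_C, neg_sub]; rfl
  rw [h2, det_neg, ← card_roots_charpoly A] at h1
  rw [eval_charpoly, eval_multiset_prod, Multiset.map_map, Multiset.map_map]
  have h3 := Multiset.prod_map_neg (A.charpoly.roots.map fun l => (X ^ k - C t).eval l)
  rw [Multiset.map_map, Multiset.card_map, ← h1, ← mul_assoc, ← mul_pow] at h3
  simp at h3
  simpa using h3.symm

/-- The trace of `A ^ k` is the `k`-th power sum of the eigenvalues of `A`. -/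
lemma trace_pow_eq_sum_roots (A : Matrix ι ι K) (k : ℕ) :
    (A ^ k).trace = (A.charpoly.roots.map (· ^ k)).sum := by
  rcases eq_or_ne k 0 with rfl | hk
  · simp [card_roots_charpoly]
  · rw [trace_eq_sum_roots_charpoly, charpoly_pow_eq A hk, roots_multiset_prod_X_sub_C]

lemma exists_trace_pow_eq_sum (A : Matrix ι ι K) :
    ∃ x : Fin (Fintype.card ι) → K, ∀ k, (A ^ k).trace = ∑ i, x i ^ k := by
  have hl : A.charpoly.roots.toList.length = Fintype.card ι := by
    rw [Multiset.length_toList, card_roots_charpoly]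
  refine ⟨fun i => A.charpoly.roots.toList.get (i.cast hl.symm), fun k => ?_⟩
  rw [trace_pow_eq_sum_roots]
  conv_lhs => rw [← Multiset.coe_toList A.charpoly.roots]
  rw [Multiset.map_coe, Multiset.sum_coe, ← List.sum_ofFn]
  congr 1
  refine List.ext_get (by simp [hl]) fun n h1 h2 => by simp

end Matrix

section Gradient

open Finset.HasAntidiagonal (antidiagonal mem_antidiagonal)

variable {ι : Type*} [Fintype ι] [DecidableEq ι]

lemma exp_smul_mem_unitaryGroup {X : Matrix ι ι ℂ} (hX : Xᴴ = -X) (t : ℝ) :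
    NormedSpace.exp (t • X) ∈ unitaryGroup ι ℂ := by
  rw [mem_unitaryGroup_iff, star_eq_conjTranspose, ← exp_conjTranspose, conjTranspose_smul, hX,
    star_trivial, smul_neg, ← exp_add_of_commute _ _ (Commute.refl (t • X)).neg_right,
    add_neg_cancel, NormedSpace.exp_zero]

/-- The one-parameter group of unitary matrices generated by a skew-Hermitian matrix. -/
def unitaryFlow {X : Matrix ι ι ℂ} (hX : Xᴴ = -X) (t : ℝ) : unitaryGroup ι ℂ :=
  ⟨NormedSpace.exp (t • X), exp_smul_mem_unitaryGroup hX t⟩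

lemma unitaryFlow_zero {X : Matrix ι ι ℂ} (hX : Xᴴ = -X) : unitaryFlow hX 0 = 1 := by
  exact Subtype.ext (by simp [unitaryFlow])

lemma unitaryFlow_add {X : Matrix ι ι ℂ} (hX : Xᴴ = -X) (s t : ℝ) :
    unitaryFlow hX (s + t) = unitaryFlow hX s * unitaryFlow hX t := by
  refine Subtype.ext ?_
  simp only [unitaryFlow, add_smul]
  exact exp_add_of_commute _ _ (((Commute.refl X).smul_left s).smul_right t)

lemma hasDerivAt_unitaryFlow {X : Matrix ι ι ℂ} (hX : Xᴴ = -X) (i j : ι) :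
    HasDerivAt (fun t => (unitaryFlow hX t : Matrix ι ι ℂ) i j) (X i j) 0 := by
  let : NormedRing (Matrix ι ι ℂ) := Matrix.linftyOpNormedRing
  let : NormedAlgebra ℝ (Matrix ι ι ℂ) := Matrix.linftyOpNormedAlgebra
  have h1 := hasDerivAt_exp_smul_const' (𝕂 := ℝ) X 0
  rw [zero_smul, NormedSpace.exp_zero, mul_one] at h1
  exact (LinearMap.toContinuousLinearMap (entryLinearMap ℝ ℂ i j)).hasFDerivAt.comp_hasDerivAt 0 h1

/-- `g` is the gradient of `f`: the derivative of `f` along the flow generated by a skew-Hermitian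
matrix `X` is `tr (X g)`. -/
structure HasGradient (f : unitaryGroup ι ℂ → ℂ) (g : unitaryGroup ι ℂ → Matrix ι ι ℂ) : Prop where
  continuous_left : Continuous f
  continuous_right : Continuous g
  hasDerivAt_zero : ∀ (X : Matrix ι ι ℂ) (hX : Xᴴ = -X) (v : unitaryGroup ι ℂ),
    HasDerivAt (fun t => f (unitaryFlow hX t * v)) (X * g v).trace 0

namespace HasGradient

variable {f f₁ f₂ : unitaryGroup ι ℂ → ℂ} {g g₁ g₂ : unitaryGroup ι ℂ → Matrix ι ι ℂ}

lemma congr (h : HasGradient f₁ g₁) (hf : ∀ v, f v = f₁ v) (hg : ∀ v, g v = g₁ v) :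
    HasGradient f g := by
  rwa [funext hf, funext hg]

lemma const (c : ℂ) : HasGradient (fun _ : unitaryGroup ι ℂ => c) (fun _ => 0) where
  continuous_left := by fun_prop
  continuous_right := by fun_prop
  hasDerivAt_zero X hX v := by simpa using hasDerivAt_const (0 : ℝ) c

lemma mul (h₁ : HasGradient f₁ g₁) (h₂ : HasGradient f₂ g₂) :
    HasGradient (fun v => f₁ v * f₂ v) (fun v => f₂ v • g₁ v + f₁ v • g₂ v) where
  continuous_left := h₁.continuous_left.mul h₂.continuous_left
  continuous_right := (h₂.continuous_left.smul h₁.continuous_right).add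
    (h₁.continuous_left.smul h₂.continuous_right)
  hasDerivAt_zero X hX v := by
    refine ((h₁.hasDerivAt_zero X hX v).mul (h₂.hasDerivAt_zero X hX v)).congr_deriv ?_
    simp [unitaryFlow_zero, mul_add, mul_comm]

lemma const_mul (c : ℂ) (h : HasGradient f g) :
    HasGradient (fun v => c * f v) (fun v => c • g v) :=
  ((const c).mul h).congr (fun _ => rfl) fun v => by simp

lemma sum {κ : Type*} (s : Finset κ) {f : κ → unitaryGroup ι ℂ → ℂ}
    {g : κ → unitaryGroup ι ℂ → Matrix ι ι ℂ} (h : ∀ k ∈ s, HasGradient (f k) (g k)) :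
    HasGradient (fun v => ∑ k ∈ s, f k v) (fun v => ∑ k ∈ s, g k v) where
  continuous_left := continuous_finsetSum s fun k hk => (h k hk).continuous_left
  continuous_right := continuous_finsetSum s fun k hk => (h k hk).continuous_right
  hasDerivAt_zero X hX v := by
    rw [Finset.mul_sum, trace_sum]
    exact HasDerivAt.fun_sum fun k hk => (h k hk).hasDerivAt_zero X hX v

lemma star (h : HasGradient f g) :
    HasGradient (fun v => starRingEnd ℂ (f v)) (fun v => -(g v)ᴴ) where
  continuous_left := Complex.continuous_conj.comp h.continuous_left
  continuous_right := h.continuous_right.matrix_conjTranspose.neg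
  hasDerivAt_zero X hX v := by
    refine (h.hasDerivAt_zero X hX v).star.congr_deriv ?_
    rw [← trace_conjTranspose, conjTranspose_mul, hX, mul_neg, mul_neg, trace_neg, trace_neg,
      trace_mul_comm]

lemma entry (i j : ι) : HasGradient (fun v : unitaryGroup ι ℂ => (v : Matrix ι ι ℂ) i j)
    (fun v => (v : Matrix ι ι ℂ) * single j i 1) where
  continuous_left := continuous_subtype_val.matrix_elem i j
  continuous_right := continuous_subtype_val.matrix_mul continuous_const
  hasDerivAt_zero X hX v := by
    have h1 : (X * ((v : Matrix ι ι ℂ) * single j i 1)).trace =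
        ∑ l, X i l * (v : Matrix ι ι ℂ) l j := by
      rw [← mul_assoc, trace_mul_single]
      simp [mul_apply]
    rw [h1]
    simp only [Submonoid.coe_mul, mul_apply]
    exact HasDerivAt.fun_sum fun l _ => (hasDerivAt_unitaryFlow hX i l).mul_const _

lemma pow_entry (k : ℕ) (i j : ι) :
    HasGradient (fun v : unitaryGroup ι ℂ => ((v : Matrix ι ι ℂ) ^ k) i j)
      (fun v => ∑ a ∈ Finset.range k,
        (v : Matrix ι ι ℂ) ^ (k - a) * single j i 1 * (v : Matrix ι ι ℂ) ^ a) := by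
  induction k generalizing i j with
  | zero => simpa [one_apply] using const (if i = j then 1 else 0)
  | succ k ih =>
    refine (sum Finset.univ fun l _ => (ih i l).mul (entry l j)).congr (fun v => ?_) fun v => ?_
    · rw [pow_succ, mul_apply]
    · set V := (v : Matrix ι ι ℂ)
      rw [Finset.sum_add_distrib, Finset.sum_range_succ]
      have h1 : ∑ l, V l j • single l i (1 : ℂ) = V * single j i 1 := by
        ext a b
        simp [Matrix.sum_apply, single_apply, mul_apply, ite_and]
      have h2 : ∑ l, (V ^ k) i l • single j l (1 : ℂ) = single j i 1 * V ^ k := by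
        ext a b
        simp [Matrix.sum_apply, single_apply, mul_apply, ite_and]
      congr 1
      · simp only [Finset.smul_sum]
        rw [Finset.sum_comm]
        refine Finset.sum_congr rfl fun a ha => ?_
        rw [show k + 1 - a = k - a + 1 by have := Finset.mem_range.mp ha; omega, pow_succ,
          mul_assoc (V ^ (k - a)), ← h1]
        simp only [Finset.mul_sum, Finset.sum_mul, mul_smul_comm, smul_mul_assoc]
      · rw [show k + 1 - k = 1 by omega, pow_one, mul_assoc, ← h2]
        simp only [Finset.mul_sum, mul_smul_comm]

end HasGradient

/-- The power sum `tr (Vᵏ)` as a continuous function on the unitary group. -/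
def powerTrace (ι : Type*) [Fintype ι] [DecidableEq ι] (k : ℕ) : C(unitaryGroup ι ℂ, ℂ) where
  toFun v := ((v : Matrix ι ι ℂ) ^ k).trace
  continuous_toFun := (continuous_subtype_val.pow k).matrix_trace

lemma hasGradient_powerTrace (k : ℕ) :
    HasGradient (powerTrace ι k) fun v => k • (v : Matrix ι ι ℂ) ^ k := by
  refine (HasGradient.sum Finset.univ fun i _ => HasGradient.pow_entry k i i).congr
    (fun v => rfl) fun v => ?_
  rw [Finset.sum_comm]
  have h1 : ∑ i : ι, single i i (1 : ℂ) = 1 := by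
    ext a b
    simp [Matrix.sum_apply, single_apply, one_apply, ite_and]
  have h2 : ∀ a ∈ Finset.range k, ∑ i : ι, (v : Matrix ι ι ℂ) ^ (k - a) * single i i 1 *
      (v : Matrix ι ι ℂ) ^ a = (v : Matrix ι ι ℂ) ^ k := by
    intro a ha
    rw [← Finset.sum_mul, ← Finset.mul_sum, h1, mul_one, ← pow_add,
      Nat.sub_add_cancel (Finset.mem_range.mp ha).le]
  rw [Finset.sum_congr rfl h2]
  simp

lemma IsNewtonSeq.hasGradient {ε : ℤ} {s : ℕ → C(unitaryGroup ι ℂ, ℂ)}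
    (hs : IsNewtonSeq ε (powerTrace ι) s) (n : ℕ) :
    HasGradient (s n) fun v => ∑ x ∈ antidiagonal n,
      ((newtonWeight ε x.1 : ℂ) * s x.2 v) • (v : Matrix ι ι ℂ) ^ x.1 := by
  induction n using Nat.strong_induction_on with
  | _ n ih =>
    rcases Nat.eq_zero_or_pos n with rfl | hn
    · refine (HasGradient.const 1).congr (fun v => by simp [hs.1]) fun v => by
        simp [newtonWeight_zero]
    have hval : ∀ (m : ℕ) v, (m : ℂ) * s m v = ∑ x ∈ antidiagonal m,
        (newtonWeight ε x.1 : ℂ) * (powerTrace ι x.1 v * s x.2 v) := by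
      intro m v
      have := DFunLike.congr_fun (hs.2 m) v
      simpa [mul_assoc] using this
    have hn' : (n : ℂ) ≠ 0 := by exact_mod_cast hn.ne'
    have h1 : ∀ x ∈ antidiagonal n, HasGradient
        (fun v => (newtonWeight ε x.1 : ℂ) * (powerTrace ι x.1 v * s x.2 v))
        (fun v => (newtonWeight ε x.1 : ℂ) • (s x.2 v • (x.1 • (v : Matrix ι ι ℂ) ^ x.1) +
          powerTrace ι x.1 v • ∑ y ∈ antidiagonal x.2,
            ((newtonWeight ε y.1 : ℂ) * s y.2 v) • (v : Matrix ι ι ℂ) ^ y.1)) := by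
      intro x hx
      rcases Nat.eq_zero_or_pos x.1 with h0 | h0
      · simpa [h0, newtonWeight_zero] using HasGradient.const (ι := ι) 0
      · exact ((hasGradient_powerTrace x.1).mul
          (ih x.2 (by have := mem_antidiagonal.mp hx; omega))).const_mul _
    refine ((HasGradient.sum _ h1).const_mul (n : ℂ)⁻¹).congr (fun v => ?_) fun v => ?_
    · rw [← hval, inv_mul_cancel_left₀ hn']
    · rw [eq_inv_smul_iff₀ hn']
      set V := (v : Matrix ι ι ℂ)
      simp only [smul_add, Finset.sum_add_distrib, Finset.smul_sum, smul_smul]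
      rw [Finset.sum_sigma' (antidiagonal n) fun x => antidiagonal x.2]
      have h2 : ∑ x ∈ (antidiagonal n).sigma fun x => antidiagonal x.2,
          ((newtonWeight ε x.1.1 : ℂ) * (powerTrace ι x.1.1 v *
            ((newtonWeight ε x.2.1 : ℂ) * s x.2.2 v))) • V ^ x.2.1 =
          ∑ x ∈ antidiagonal n, ((newtonWeight ε x.1 : ℂ) * (x.2 * s x.2 v)) • V ^ x.1 := by
        simp only [hval, Finset.mul_sum, Finset.sum_smul]
        rw [Finset.sum_sigma']
        refine Finset.sum_nbij' (fun x => ⟨(x.2.1, x.1.1 + x.2.2), (x.1.1, x.2.2)⟩)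
          (fun x => ⟨(x.2.1, x.1.1 + x.2.2), (x.1.1, x.2.2)⟩) ?_ ?_ ?_ ?_ ?_
        · rintro ⟨⟨a, b⟩, ⟨c, d⟩⟩ h; simp at h ⊢; omega
        · rintro ⟨⟨a, b⟩, ⟨c, d⟩⟩ h; simp at h ⊢; omega
        · rintro ⟨⟨a, b⟩, ⟨c, d⟩⟩ h; simp at h ⊢; omega
        · rintro ⟨⟨a, b⟩, ⟨c, d⟩⟩ h; simp at h ⊢; omega
        · rintro ⟨⟨a, b⟩, ⟨c, d⟩⟩ h; congr 1; ring
      rw [h2, ← Finset.sum_add_distrib]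
      refine Finset.sum_congr rfl fun x hx => ?_
      rw [← mem_antidiagonal.mp hx, ← Nat.cast_smul_eq_nsmul ℂ, smul_smul, ← add_smul]
      congr 1
      push_cast; ring

end Gradient

section LoopEquation

open Finset.HasAntidiagonal (antidiagonal mem_antidiagonal)

variable {ι : Type*} [Fintype ι] [DecidableEq ι]

instance compactSpace_unitaryGroup : CompactSpace (unitaryGroup ι ℂ) := by
  refine isCompact_iff_compactSpace.mp (IsCompact.of_isClosed_subset
    (isCompact_univ_pi fun _ => isCompact_univ_pi fun _ =>
      isCompact_closedBall (0 : ℂ) 1) isClosed_unitary ?_)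
  intro U hU i _ j _
  simpa using entry_norm_bound_of_unitary hU i j

variable (μ : Measure (unitaryGroup ι ℂ))

lemma Continuous.integrable_unitaryGroup [IsFiniteMeasure μ] {E : Type*} [NormedAddCommGroup E]
    {f : unitaryGroup ι ℂ → E} (hf : Continuous f) : Integrable f μ :=
  hf.integrable_of_hasCompactSupport (HasCompactSupport.of_compactSpace f)

namespace HasGradient

variable {f : unitaryGroup ι ℂ → ℂ} {g : unitaryGroup ι ℂ → Matrix ι ι ℂ}

lemma hasDerivAt (h : HasGradient f g) {X : Matrix ι ι ℂ} (hX : Xᴴ = -X)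
    (v : unitaryGroup ι ℂ) (t : ℝ) :
    HasDerivAt (fun s => f (unitaryFlow hX s * v)) (X * g (unitaryFlow hX t * v)).trace t := by
  have h1 := h.hasDerivAt_zero X hX (unitaryFlow hX t * v)
  rw [← sub_self t] at h1
  refine (h1.comp_sub_const t t).congr_of_eventuallyEq (Filter.Eventually.of_forall fun s => ?_)
  simp only [← mul_assoc, ← unitaryFlow_add, sub_add_cancel]

lemma integral_skew [IsFiniteMeasure μ] [μ.IsMulLeftInvariant] (h : HasGradient f g)
    {X : Matrix ι ι ℂ} (hX : Xᴴ = -X) : ∫ v, (X * g v).trace ∂μ = 0 := by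
  have hc : Continuous fun v => (X * g v).trace :=
    (continuous_const.matrix_mul h.continuous_right).matrix_trace
  obtain ⟨C, hC⟩ := isCompact_univ.exists_bound_of_continuousOn hc.continuousOn
  have h1 := (hasDerivAt_integral_of_dominated_loc_of_deriv_le (μ := μ) (𝕜 := ℝ)
    (F := fun t v => f (unitaryFlow hX t * v))
    (F' := fun t v => (X * g (unitaryFlow hX t * v)).trace) (x₀ := 0) (bound := fun _ => C)
    Filter.univ_mem
    (Filter.Eventually.of_forall fun t =>
      (Continuous.integrable_unitaryGroup μ
        (h.continuous_left.comp (continuous_const_mul _))).aestronglyMeasurable)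
    (Continuous.integrable_unitaryGroup μ (h.continuous_left.comp (continuous_const_mul _)))
    (Continuous.integrable_unitaryGroup μ
      (hc.comp (continuous_const_mul _))).aestronglyMeasurable
    (Filter.Eventually.of_forall fun v t _ => hC _ (Set.mem_univ _))
    (integrable_const C)
    (Filter.Eventually.of_forall fun v t _ => h.hasDerivAt hX v t)).2
  simp only [integral_mul_left_eq_self f, unitaryFlow_zero, one_mul] at h1
  exact h1.unique (hasDerivAt_const _ _)

lemma integral_trace_mul [IsFiniteMeasure μ] [μ.IsMulLeftInvariant] (h : HasGradient f g)
    (X : Matrix ι ι ℂ) : ∫ v, (X * g v).trace ∂μ = 0 := by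
  have hA : (X - Xᴴ)ᴴ = -(X - Xᴴ) := by simp
  have hB : (Complex.I • (X + Xᴴ))ᴴ = -(Complex.I • (X + Xᴴ)) := by
    simp [add_comm]
  have h1 : ∀ v, (X * g v).trace = (1 / 2 : ℂ) * ((X - Xᴴ) * g v).trace +
      (-Complex.I / 2) * ((Complex.I • (X + Xᴴ)) * g v).trace := by
    intro v
    simp only [sub_mul, smul_mul_assoc, add_mul, trace_sub, trace_smul, trace_add, smul_eq_mul]
    linear_combination (1 / 2 * ((X * g v).trace + (Xᴴ * g v).trace)) * Complex.I_mul_I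
  have hi : ∀ Y : Matrix ι ι ℂ, Integrable (fun v => (Y * g v).trace) μ := fun Y =>
    Continuous.integrable_unitaryGroup μ
      (continuous_const.matrix_mul h.continuous_right).matrix_trace
  simp only [h1]
  rw [integral_add ((hi _).const_mul _) ((hi _).const_mul _), integral_const_mul,
    integral_const_mul, h.integral_skew μ hA, h.integral_skew μ hB]
  simp

lemma integral_apply [IsFiniteMeasure μ] [μ.IsMulLeftInvariant] (h : HasGradient f g) (i j : ι) :
    ∫ v, g v i j ∂μ = 0 := by
  rw [← h.integral_trace_mul μ (single j i 1)]
  refine integral_congr_ae (Filter.Eventually.of_forall fun v => ?_)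
  simp [trace_single_mul]

/-- The loop equation on the unitary group. -/
theorem integral_loop [IsFiniteMeasure μ] [μ.IsMulLeftInvariant] {c : unitaryGroup ι ℂ → ℂ}
    (h : HasGradient c g) {k n : ℕ} (hkn : k ≤ n) :
    ∫ v, (((v : Matrix ι ι ℂ) ^ k * g v).trace + c v * ∑ a ∈ Finset.range k,
      powerTrace ι a v * powerTrace ι (k - a) v) * starRingEnd ℂ (powerTrace ι n v) ∂μ =
    n * ∫ v, c v * starRingEnd ℂ (powerTrace ι (n - k) v) ∂μ := by
  have hgrad := fun i j => ((pow_entry (ι := ι) k i j).mul h).mul (hasGradient_powerTrace n).star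
  have hzero := fun i j => (hgrad i j).integral_apply μ j i
  have hentry := fun i j => Continuous.integrable_unitaryGroup μ
    ((hgrad i j).continuous_right.matrix_elem j i)
  have hsum := integral_finsetSum (μ := μ) Finset.univ fun i _ =>
    integrable_finsetSum Finset.univ fun j _ => hentry i j
  simp only [integral_finsetSum Finset.univ fun j _ => hentry _ j, hzero,
    Finset.sum_const_zero] at hsum
  have hpt : ∀ v : unitaryGroup ι ℂ, ∑ i, ∑ j,
      (starRingEnd ℂ (powerTrace ι n v) • (c v • (∑ a ∈ Finset.range k,
        (v : Matrix ι ι ℂ) ^ (k - a) * single j i 1 * (v : Matrix ι ι ℂ) ^ a) +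
        ((v : Matrix ι ι ℂ) ^ k) i j • g v) +
      (((v : Matrix ι ι ℂ) ^ k) i j * c v) • -(n • (v : Matrix ι ι ℂ) ^ n)ᴴ) j i =
      (((v : Matrix ι ι ℂ) ^ k * g v).trace + c v * ∑ a ∈ Finset.range k,
        powerTrace ι a v * powerTrace ι (k - a) v) * starRingEnd ℂ (powerTrace ι n v) -
      n * (c v * starRingEnd ℂ (powerTrace ι (n - k) v)) := by
    intro v
    set V := (v : Matrix ι ι ℂ) with hV
    have e1 : ∑ i, ∑ j, (∑ a ∈ Finset.range k, V ^ (k - a) * single j i 1 * V ^ a : Matrix ι ι ℂ) j i =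
        ∑ a ∈ Finset.range k, powerTrace ι a v * powerTrace ι (k - a) v := by
      have : ∀ a i j, (V ^ (k - a) * single j i 1 * V ^ a : Matrix ι ι ℂ) j i =
          (V ^ a) i i * (V ^ (k - a)) j j := by
        intro a i j
        rw [mul_apply, Finset.sum_eq_single i]
        · simp [mul_comm]
        · intro b _ hb; simp [hb]
        · simp
      simp only [Matrix.sum_apply, this]
      rw [Finset.sum_congr rfl fun i _ => Finset.sum_comm, Finset.sum_comm]
      refine Finset.sum_congr rfl fun a _ => ?_
      simp only [← Finset.mul_sum, ← Finset.sum_mul]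
      rfl
    have e2 : ∑ i, ∑ j, (V ^ k) i j * g v j i = (V ^ k * g v).trace := by
      simp only [trace, diag, mul_apply]
    have e3 : ∑ i, ∑ j, (V ^ k) i j * (V ^ n)ᴴ j i = starRingEnd ℂ (powerTrace ι (n - k) v) := by
      have h1 : V ^ k * (V ^ n)ᴴ = (V ^ (n - k))ᴴ := by
        have h2 : V ^ k * (V ^ k)ᴴ = 1 := by
          have := (mem_unitaryGroup_iff (A := V ^ k)).mp (pow_mem v.2 k)
          rwa [star_eq_conjTranspose] at this
        conv_lhs => rw [← Nat.sub_add_cancel hkn, pow_add, conjTranspose_mul, ← mul_assoc, h2,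
          one_mul]
      have h3 : starRingEnd ℂ (powerTrace ι (n - k) v) = (V ^ k * (V ^ n)ᴴ).trace := by
        rw [h1, trace_conjTranspose]; rfl
      rw [h3]
      simp only [trace, diag, mul_apply]
    rw [← e1, ← e2, ← e3]
    simp only [Finset.mul_sum, Finset.sum_mul, ← Finset.sum_add_distrib, ← Finset.sum_sub_distrib]
    refine Finset.sum_congr rfl fun i _ => Finset.sum_congr rfl fun j _ => ?_
    simp only [Matrix.add_apply, Matrix.smul_apply, Matrix.neg_apply, smul_eq_mul,
      conjTranspose_nsmul, nsmul_eq_mul (n : ℕ) (_ : ℂ)]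
    ring
  have hc1 := h.continuous_left
  have hc2 := h.continuous_right
  simp only [hpt] at hsum
  rw [integral_sub, integral_const_mul, sub_eq_zero] at hsum
  · exact hsum
  · refine Continuous.integrable_unitaryGroup μ (Continuous.mul (Continuous.add ?_ ?_) ?_)
    · exact ((continuous_subtype_val.pow k).matrix_mul hc2).matrix_trace
    · fun_prop
    · exact Complex.continuous_conj.comp (map_continuous _)
  · exact Continuous.integrable_unitaryGroup μ (continuous_const.mul (hc1.mul
      (Complex.continuous_conj.comp (map_continuous _))))

end HasGradient

end LoopEquation

section FormFactor

open Finset.HasAntidiagonal (antidiagonal mem_antidiagonal)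

variable {ι : Type*} [Fintype ι] [DecidableEq ι]

instance isAddTorsionFree_continuousMap {Y : Type*} [TopologicalSpace Y] :
    IsAddTorsionFree C(Y, ℂ) where
  nsmul_right_injective n hn f g h := by
    ext y
    have := DFunLike.congr_fun h y
    simpa [hn] using this

/-- The functional `f ↦ ∫ f * conj (tr Vⁿ)`. -/
def powerTracePairing (μ : Measure (unitaryGroup ι ℂ)) [IsFiniteMeasure μ] (n : ℕ) :
    C(unitaryGroup ι ℂ, ℂ) →ₗ[ℂ] ℂ where
  toFun f := ∫ v, f v * starRingEnd ℂ (powerTrace ι n v) ∂μ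
  map_add' f g := by
    have hi : ∀ f : C(unitaryGroup ι ℂ, ℂ),
        Integrable (fun v => f v * starRingEnd ℂ (powerTrace ι n v)) μ := fun f =>
      Continuous.integrable_unitaryGroup μ ((map_continuous f).mul
        (Complex.continuous_conj.comp (map_continuous _)))
    simp only [ContinuousMap.add_apply, add_mul]
    exact integral_add (hi f) (hi g)
  map_smul' a f := by
    simp only [ContinuousMap.smul_apply, smul_eq_mul, mul_assoc, RingHom.id_apply]
    exact integral_const_mul a _

lemma loopEquations_powerTracePairing (μ : Measure (unitaryGroup ι ℂ)) [IsFiniteMeasure μ]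
    [μ.IsMulLeftInvariant] {e h : ℕ → C(unitaryGroup ι ℂ, ℂ)}
    (he : IsNewtonSeq (-1) (powerTrace ι) e) (hh : IsNewtonSeq 1 (powerTrace ι) h) :
    LoopEquations (powerTrace ι) e h (powerTracePairing μ) := by
  intro n k j m _ hkn
  refine Eq.trans ?_ (((he.hasGradient j).mul (hh.hasGradient m)).integral_loop μ hkn)
  refine integral_congr_ae (Filter.Eventually.of_forall fun v => ?_)
  have h1 : ∀ (b : ℂ) (s : Finset (ℕ × ℕ)) (w : ℕ × ℕ → ℂ),
      ((v : Matrix ι ι ℂ) ^ k * b • ∑ x ∈ s, w x • (v : Matrix ι ι ℂ) ^ x.1).trace =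
        ∑ x ∈ s, w x * powerTrace ι (k + x.1) v * b := by
    intro b s w
    simp only [Finset.smul_sum, Finset.mul_sum, trace_sum, mul_smul_comm, trace_smul, ← pow_add,
      smul_eq_mul]
    refine Finset.sum_congr rfl fun x _ => ?_
    simp only [powerTrace, ContinuousMap.coe_mk]
    ring
  simp only [mul_add, trace_add, h1, loopTerm]
  simp

lemma powerTrace_zero : powerTrace ι 0 = (Fintype.card ι : C(unitaryGroup ι ℂ, ℂ)) := by
  ext v
  simp [powerTrace]

lemma IsNewtonSeq.eq_zero_of_powerTrace {e : ℕ → C(unitaryGroup ι ℂ, ℂ)}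
    (he : IsNewtonSeq (-1) (powerTrace ι) e) {j : ℕ} (hj : Fintype.card ι < j) : e j = 0 := by
  ext v
  obtain ⟨x, hx⟩ := exists_trace_pow_eq_sum (v : Matrix ι ι ℂ)
  have h1 : IsNewtonSeq (-1) (fun k => ∑ i, x i ^ k) fun n => e n v := by
    refine ⟨by simp [he.1], fun n => ?_⟩
    have := DFunLike.congr_fun (he.2 n) v
    simpa [powerTrace, hx] using this
  simpa using h1.eq_zero_of_card_lt (j := j) (by simpa using hj)

theorem integral_normSq_trace_pow [Nonempty ι] (μ : Measure (unitaryGroup ι ℂ))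
    [IsProbabilityMeasure μ] [μ.IsMulLeftInvariant] {n : ℕ} (hn : 1 ≤ n) :
    ∫ v : unitaryGroup ι ℂ, Complex.normSq (((v : Matrix ι ι ℂ) ^ n).trace) ∂μ =
      (min n (Fintype.card ι) : ℕ) := by
  have he := isNewtonSeq_newtonSeq (-1) (powerTrace ι)
  have hh := isNewtonSeq_newtonSeq 1 (powerTrace ι)
  have h0 : powerTracePairing μ 0 1 = Fintype.card ι := by
    simp [powerTracePairing, powerTrace_zero]
  have h1 := (loopEquations_powerTracePairing μ he hh).map_powerSum he hh Fintype.card_pos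
    powerTrace_zero h0 (fun j hj => he.eq_zero_of_powerTrace hj) hn
  have h2 : powerTracePairing μ n (powerTrace ι n) =
      ∫ v : unitaryGroup ι ℂ, (Complex.normSq (((v : Matrix ι ι ℂ) ^ n).trace) : ℂ) ∂μ :=
    integral_congr_ae (Filter.Eventually.of_forall fun v => Complex.mul_conj _)
  rw [h1, integral_complex_ofReal] at h2
  exact Complex.ofReal_injective (h2.symm.trans (Complex.ofReal_natCast _).symm)

end FormFactor

/-- The average form factor over the Haar probability measure on
`U(N)`: `∫ |tr(V^n)|² dV = n` if `n ≤ N` and `= N` if `n > N`. -/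
theorem average_form_factor (N : ℕ) (hN : 1 ≤ N) (n : ℕ) (hn : 1 ≤ n)
    (μ : Measure (Matrix.unitaryGroup (Fin N) ℂ)) [μ.IsHaarMeasure] [IsProbabilityMeasure μ] :
    (n ≤ N →
      (∫ v : Matrix.unitaryGroup (Fin N) ℂ,
          Complex.normSq (((v : Matrix (Fin N) (Fin N) ℂ) ^ n).trace) ∂μ) = (n : ℝ)) ∧
    (N < n →
      (∫ v : Matrix.unitaryGroup (Fin N) ℂ,
          Complex.normSq (((v : Matrix (Fin N) (Fin N) ℂ) ^ n).trace) ∂μ) = (N : ℝ)) := by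
  have : Nonempty (Fin N) := ⟨⟨0, hN⟩⟩
  have h := integral_normSq_trace_pow μ hn
  rw [Fintype.card_fin] at h
  refine ⟨fun hle => ?_, fun hlt => ?_⟩
  · rw [h, min_eq_left hle]
  · rw [h, min_eq_right hlt.le]
end
end
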